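/- Let g ≥ 2 and k ∈ ℕ, and let F be a non-zero Siegel cusp form of weight k on Γ_g = Sp_g(ℤ) with Fourier coefficients a(T). Then there exists a positive definite half-integral symmetric g×g matrix T₀ with a(T₀) ≠ 0 and tr T₀ ≤ (k/(4π)) · (2/√3) · g · (4/3)^{g(g−1)/2}. -/

import Mathlib

open scoped BigOperators
open Complex Matrix

noncomputable section

attribute [local instance] Matrix.normedAddCommGroup Matrix.normedSpace

/-- A positive definite half-integral symmetric real matrix: symmetric, positive definite,
integral diagonal entries, and off-diagonal entries in `½ℤ`. -/
def IsPDHalfIntegral {g : ℕ} (T : Matrix (Fin g) (Fin g) ℝ) : Prop :=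
  T.IsSymm ∧ T.PosDef ∧ (∀ i, ∃ n : ℤ, T i i = (n : ℝ)) ∧
    (∀ i j, i ≠ j → ∃ n : ℤ, T i j = (n : ℝ) / 2)

/-- The Siegel upper half-space of genus `g`: symmetric complex matrices with positive
definite imaginary part. -/
def SiegelUpperHalf (g : ℕ) : Set (Matrix (Fin g) (Fin g) ℂ) :=
  {Z | Z.IsSymm ∧ (Z.map Complex.im).PosDef}

/-- A Siegel cusp form of weight `k` on `Sp_g(ℤ)`, bundled with its Fourier
coefficients `coeff`. -/
structure SiegelCuspForm (g k : ℕ) where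
  toFun : Matrix (Fin g) (Fin g) ℂ → ℂ
  coeff : Matrix (Fin g) (Fin g) ℝ → ℂ
  holo : DifferentiableOn ℂ toFun (SiegelUpperHalf g)
  transform : ∀ A B C D : Matrix (Fin g) (Fin g) ℤ,
    Matrix.fromBlocks A B C D ∈ Matrix.symplecticGroup (Fin g) ℤ →
    ∀ Z ∈ SiegelUpperHalf g,
      toFun ((A.map (Int.cast : ℤ → ℂ) * Z + B.map (Int.cast : ℤ → ℂ)) *
             (C.map (Int.cast : ℤ → ℂ) * Z + D.map (Int.cast : ℤ → ℂ))⁻¹) =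
        (C.map (Int.cast : ℤ → ℂ) * Z + D.map (Int.cast : ℤ → ℂ)).det ^ k * toFun Z
  fourier : ∀ Z ∈ SiegelUpperHalf g,
    toFun Z = ∑' T : {T : Matrix (Fin g) (Fin g) ℝ // IsPDHalfIntegral T},
      coeff T.1 * Complex.exp (2 * Real.pi * Complex.I *
        ((T.1.map (Complex.ofReal)) * Z).trace)

section RealMatrices

variable {n : Type*} [Fintype n] [DecidableEq n]

lemma det_one_add_smul_eq_prod {N : Matrix n n ℝ} (hN : N.IsHermitian) (c : ℝ) :
    (1 + c • N).det = ∏ i, (1 + c * hN.eigenvalues i) := by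
  have hU : (hN.eigenvectorUnitary : Matrix n n ℝ) *
      (star hN.eigenvectorUnitary : Matrix n n ℝ) = 1 := by simp
  have h : 1 + c • N = (hN.eigenvectorUnitary : Matrix n n ℝ) *
      diagonal (fun i => 1 + c * hN.eigenvalues i) *
      (star hN.eigenvectorUnitary : Matrix n n ℝ) := by
    have hd : diagonal (fun i => 1 + c * hN.eigenvalues i) =
        (1 : Matrix n n ℝ) + c • diagonal hN.eigenvalues := by
      ext i j
      by_cases hij : i = j <;> simp [hij]
    have hs := hN.spectral_theorem
    rw [Unitary.conjStarAlgAut_apply] at hs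
    rw [hd, Matrix.mul_add, Matrix.add_mul, Matrix.mul_one, hU, Matrix.mul_smul, Matrix.smul_mul]
    conv_lhs => rw [hs]
    rfl
  have h2 := congrArg Matrix.det hU
  rw [det_mul, det_one] at h2
  rw [h, det_mul, det_mul, mul_right_comm, h2, one_mul, det_diagonal]

lemma Matrix.PosSemidef.exists_eq_transpose_mul_self {A : Matrix n n ℝ} (hA : A.PosSemidef) :
    ∃ B : Matrix n n ℝ, A = Bᵀ * B := by
  have hs := hA.1.spectral_theorem
  rw [Unitary.conjStarAlgAut_apply] at hs
  refine ⟨diagonal (fun i => √(hA.1.eigenvalues i)) *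
    (star hA.1.eigenvectorUnitary : Matrix n n ℝ), ?_⟩
  have hd : diagonal (fun i => √(hA.1.eigenvalues i)) * diagonal (fun i => √(hA.1.eigenvalues i)) =
      diagonal (RCLike.ofReal ∘ hA.1.eigenvalues) := by
    rw [diagonal_mul_diagonal]
    congr 1
    funext i
    simp [Real.mul_self_sqrt (hA.eigenvalues_nonneg i)]
  have hT : (star hA.1.eigenvectorUnitary : Matrix n n ℝ)ᵀ = hA.1.eigenvectorUnitary := by
    rw [star_eq_conjTranspose, conjTranspose_eq_transpose_of_trivial, transpose_transpose]
  conv_lhs => rw [hs, ← hd]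
  rw [transpose_mul, hT, diagonal_transpose]
  simp only [Matrix.mul_assoc]

lemma Matrix.PosDef.exists_eq_transpose_mul_self {A : Matrix n n ℝ} (hA : A.PosDef) :
    ∃ B : Matrix n n ℝ, A = Bᵀ * B ∧ IsUnit B.det := by
  obtain ⟨B, hB⟩ := hA.posSemidef.exists_eq_transpose_mul_self
  refine ⟨B, hB, ?_⟩
  have := hA.det_pos
  rw [hB, det_mul, det_transpose] at this
  exact isUnit_iff_ne_zero.mpr fun h => by simp [h] at this

lemma trace_mul_nonneg {A B : Matrix n n ℝ} (hA : A.PosSemidef) (hB : B.PosSemidef) :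
    0 ≤ (A * B).trace := by
  obtain ⟨C, rfl⟩ := hA.exists_eq_transpose_mul_self
  rw [Matrix.mul_assoc, trace_mul_comm]
  exact (hB.mul_mul_conjTranspose_same C).trace_nonneg

lemma Matrix.PosSemidef.trace_smul_one_sub {W : Matrix n n ℝ} (hW : W.PosSemidef) :
    (W.trace • (1 : Matrix n n ℝ) - W).PosSemidef := by
  refine PosSemidef.of_dotProduct_mulVec_nonneg ?_ fun x => ?_
  · exact (isHermitian_one.smul (.all _)).sub hW.1
  obtain ⟨B, rfl⟩ := hW.exists_eq_transpose_mul_self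
  have h1 : x ⬝ᵥ ((Bᵀ * B) *ᵥ x) = ∑ i, (∑ j, B i j * x j) ^ 2 := by
    rw [← mulVec_mulVec, dotProduct_mulVec, vecMul_transpose]
    simp [dotProduct, mulVec, sq]
  have h2 : (Bᵀ * B).trace = ∑ i, ∑ j, B i j ^ 2 := by
    rw [Finset.sum_comm]
    simp [Matrix.trace, Matrix.mul_apply, sq]
  rw [sub_mulVec, dotProduct_sub, smul_mulVec, one_mulVec, dotProduct_smul]
  simp only [star_trivial]
  rw [h1, h2, sub_nonneg, smul_eq_mul, Finset.sum_mul]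
  refine Finset.sum_le_sum fun i _ => ?_
  refine (Finset.sum_mul_sq_le_sq_mul_sq _ _ _).trans_eq ?_
  simp [dotProduct, sq]

lemma Matrix.PosDef.inv_sub_inv_trace {W : Matrix n n ℝ} (hW : W.PosDef) {t : ℝ}
    (ht : 0 < t) (hWt : W.trace ≤ t) :
    (W⁻¹ - t⁻¹ • (1 : Matrix n n ℝ)).PosSemidef := by
  obtain ⟨B, hB, hu⟩ := hW.exists_eq_transpose_mul_self
  have huT : IsUnit Bᵀ.det := by rwa [det_transpose]
  have h1 : (B * Bᵀ).PosSemidef := posSemidef_self_mul_conjTranspose B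
  have h2 := h1.trace_smul_one_sub
  have h3 : (B * Bᵀ).trace = W.trace := by rw [hB, trace_mul_comm]
  rw [h3] at h2
  have h4 : (t • (1 : Matrix n n ℝ) - B * Bᵀ).PosSemidef := by
    have := h2.add ((PosSemidef.one (n := n) (R := ℝ)).smul (sub_nonneg.2 hWt))
    convert this using 1
    module
  have h5 := (h4.mul_mul_conjTranspose_same B⁻¹).smul (inv_nonneg.2 ht.le)
  have h6 : B⁻¹ * Bᵀ⁻¹ = W⁻¹ := by rw [hB, Matrix.mul_inv_rev]
  convert h5 using 1
  rw [conjTranspose_eq_transpose_of_trivial, transpose_nonsing_inv, Matrix.mul_sub, Matrix.sub_mul,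
    Matrix.mul_smul, Matrix.smul_mul, Matrix.mul_one, h6, ← Matrix.mul_assoc,
    nonsing_inv_mul _ hu, Matrix.one_mul, mul_nonsing_inv _ huT, smul_sub, smul_smul,
    inv_mul_cancel₀ ht.ne', one_smul]

lemma one_le_det_one_add {N : Matrix n n ℝ} (hN : N.PosSemidef) : 1 ≤ (1 + N).det := by
  have h := det_one_add_smul_eq_prod hN.1 1
  rw [one_smul] at h
  rw [h]
  calc (1 : ℝ) = ∏ _i : n, (1 : ℝ) := by simp
    _ ≤ _ := Finset.prod_le_prod (fun _ _ => zero_le_one) fun i _ => by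
      linarith [hN.eigenvalues_nonneg i]

lemma det_le_det_of_sub_posSemidef {A B : Matrix n n ℝ} (hB : B.PosDef)
    (hAB : (A - B).PosSemidef) : B.det ≤ A.det := by
  obtain ⟨S, hS, hu⟩ := hB.exists_eq_transpose_mul_self
  have huT : IsUnit Sᵀ.det := by rwa [det_transpose]
  have h1 := one_le_det_one_add (hAB.conjTranspose_mul_mul_same S⁻¹)
  have h2 : A = Sᵀ * (1 + S⁻¹ᴴ * (A - B) * S⁻¹) * S := by
    rw [conjTranspose_eq_transpose_of_trivial, transpose_nonsing_inv, Matrix.mul_add,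
      Matrix.add_mul, Matrix.mul_one, ← hS, ← Matrix.mul_assoc, ← Matrix.mul_assoc,
      mul_nonsing_inv _ huT, Matrix.one_mul, Matrix.mul_assoc, nonsing_inv_mul _ hu]
    simp
  have h3 : A.det = B.det * (1 + S⁻¹ᴴ * (A - B) * S⁻¹).det := by
    conv_lhs => rw [h2]
    rw [det_mul, det_mul, hS, det_mul]
    ring
  rw [h3]
  exact le_mul_of_one_le_right hB.det_pos.le h1

lemma one_sub_sum_le_prod_one_sub {ι : Type*} (s : Finset ι) (f : ι → ℝ)
    (h0 : ∀ i ∈ s, 0 ≤ f i) (h1 : ∑ i ∈ s, f i ≤ 1) :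
    1 - ∑ i ∈ s, f i ≤ ∏ i ∈ s, (1 - f i) := by
  classical
  induction s using Finset.induction_on with
  | empty => simp
  | insert a s ha ih =>
    rw [Finset.sum_insert ha] at h1 ⊢
    rw [Finset.prod_insert ha]
    have hs0 : 0 ≤ ∑ i ∈ s, f i :=
      Finset.sum_nonneg fun i hi => h0 i (Finset.mem_insert_of_mem hi)
    have ha0 := h0 a (Finset.mem_insert_self a s)
    have := ih (fun i hi => h0 i (Finset.mem_insert_of_mem hi)) (by linarith)
    nlinarith [mul_le_mul_of_nonneg_left this (show 0 ≤ 1 - f a by linarith)]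

lemma one_sub_mul_trace_le_det {W : Matrix n n ℝ} (hW : W.PosSemidef) {ε : ℝ} (hε : 0 ≤ ε)
    (h1 : ε * W.trace ≤ 1) : 1 - ε * W.trace ≤ (1 - ε • W).det := by
  have htr : W.trace = ∑ i, hW.1.eigenvalues i := by simpa using hW.1.trace_eq_sum_eigenvalues
  have h := det_one_add_smul_eq_prod hW.1 (-ε)
  rw [neg_smul, ← sub_eq_add_neg] at h
  rw [h, htr, Finset.mul_sum]
  rw [htr, Finset.mul_sum] at h1
  simpa [sub_eq_add_neg] using one_sub_sum_le_prod_one_sub Finset.univ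
    (fun i => ε * hW.1.eigenvalues i) (fun i _ => mul_nonneg hε (hW.eigenvalues_nonneg i)) h1

lemma det_mul_det_le_trace_pow {T Y : Matrix n n ℝ} (hT : T.PosSemidef) (hY : Y.PosSemidef) :
    T.det * Y.det ≤ (T * Y).trace ^ Fintype.card n := by
  obtain ⟨B, rfl⟩ := hT.exists_eq_transpose_mul_self
  have h := hY.mul_mul_conjTranspose_same B
  rw [conjTranspose_eq_transpose_of_trivial] at h
  have hdet := h.1.det_eq_prod_eigenvalues
  have htr := h.1.trace_eq_sum_eigenvalues
  simp only [RCLike.ofReal_real_eq_id, id_eq] at hdet htr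
  have h1 : (Bᵀ * B).det * Y.det = (B * Y * Bᵀ).det := by
    simp only [det_mul, det_transpose]; ring
  have h2 : (Bᵀ * B * Y).trace = (B * Y * Bᵀ).trace := by
    rw [Matrix.mul_assoc, trace_mul_comm]
  rw [h1, h2, hdet, htr]
  calc ∏ i, h.1.eigenvalues i ≤ ∏ _i : n, ∑ j, h.1.eigenvalues j :=
      Finset.prod_le_prod (fun i _ => h.eigenvalues_nonneg i) fun i hi =>
        Finset.single_le_sum (fun j _ => h.eigenvalues_nonneg j) hi
    _ = _ := by simp

end RealMatrices

section SymplecticAction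

open scoped ComplexOrder

variable {g : ℕ}

lemma posDef_map_ofReal_iff {Y : Matrix (Fin g) (Fin g) ℝ} :
    (Y.map Complex.ofReal).PosDef ↔ Y.PosDef := by
  constructor
  · intro h
    refine PosDef.of_dotProduct_mulVec_pos ?_ fun x hx => ?_
    · have h1 := h.1
      ext i j
      have h2 := congrFun (congrFun h1 i) j
      simpa using h2
    · have hx' : (fun i => (x i : ℂ)) ≠ 0 := fun h0 => hx <| by
        funext i
        simpa using congrFun h0 i
      have h1 := h.dotProduct_mulVec_pos hx'
      have h2 : star (fun i => (x i : ℂ)) ⬝ᵥ (Y.map Complex.ofReal *ᵥ fun i => (x i : ℂ)) =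
          ((star x ⬝ᵥ (Y *ᵥ x) : ℝ) : ℂ) := by
        simp [dotProduct, mulVec]
      rw [h2] at h1
      exact_mod_cast h1
  · intro h
    obtain ⟨B, hB, hu⟩ := h.exists_eq_transpose_mul_self
    have h1 : Y.map Complex.ofReal = (B.map Complex.ofReal)ᴴ * B.map Complex.ofReal := by
      rw [hB]
      ext i j
      simp [Matrix.mul_apply]
    rw [h1]
    refine PosDef.conjTranspose_mul_self _ (mulVec_injective_iff_isUnit.2 ?_)
    rw [Matrix.isUnit_iff_isUnit_det]
    have h2 : (B.map Complex.ofReal).det = ((B.det : ℝ) : ℂ) :=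
      (RingHom.map_det Complex.ofRealHom B).symm
    rw [h2, isUnit_iff_ne_zero]
    exact_mod_cast hu.ne_zero

lemma symplectic_block_relations {R : Type*} [CommRing R] {A B C D : Matrix (Fin g) (Fin g) R}
    (h : fromBlocks A B C D ∈ symplecticGroup (Fin g) R) :
    Aᵀ * C = Cᵀ * A ∧ Bᵀ * D = Dᵀ * B ∧ Aᵀ * D - Cᵀ * B = 1 ∧ C * Dᵀ = D * Cᵀ ∧
      A * Dᵀ - B * Cᵀ = 1 := by
  have h1 := SymplecticGroup.mem_iff.1 h
  have h2 := SymplecticGroup.mem_iff'.1 h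
  simp only [J, fromBlocks_transpose, fromBlocks_multiply, fromBlocks_inj, Matrix.mul_zero,
    Matrix.mul_one, Matrix.mul_neg, Matrix.neg_mul, zero_add, add_zero] at h1 h2
  obtain ⟨-, h12, -, h14⟩ := h1
  obtain ⟨h21, h22, -, h24⟩ := h2
  refine ⟨?_, ?_, ?_, ?_, ?_⟩
  · exact (add_neg_eq_zero.1 h21).symm
  · exact (add_neg_eq_zero.1 h24).symm
  · rw [← neg_inj, ← h22]; abel
  · exact (add_neg_eq_zero.1 h14).symm
  · rw [← neg_inj, ← h12]; abel

/-- The automorphy factor `CZ + D`. -/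
def siegelDenom (C D : Matrix (Fin g) (Fin g) ℤ) (Z : Matrix (Fin g) (Fin g) ℂ) :
    Matrix (Fin g) (Fin g) ℂ :=
  C.map (Int.cast : ℤ → ℂ) * Z + D.map (Int.cast : ℤ → ℂ)

/-- The fractional linear action `(AZ + B)(CZ + D)⁻¹`. -/
def siegelAct (A B C D : Matrix (Fin g) (Fin g) ℤ) (Z : Matrix (Fin g) (Fin g) ℂ) :
    Matrix (Fin g) (Fin g) ℂ :=
  siegelDenom A B Z * (siegelDenom C D Z)⁻¹

/-- The inverse of the imaginary part. -/
def imInv (Z : Matrix (Fin g) (Fin g) ℂ) : Matrix (Fin g) (Fin g) ℝ := (Z.map Complex.im)⁻¹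

lemma imInv_posDef {Z : Matrix (Fin g) (Fin g) ℂ} (hZ : Z ∈ SiegelUpperHalf g) :
    (imInv Z).PosDef := hZ.2.inv

lemma sub_conjTranspose_of_isSymm {Z : Matrix (Fin g) (Fin g) ℂ} (hZ : Z.IsSymm) :
    Z - Zᴴ = (2 * I) • (Z.map Complex.im).map Complex.ofReal := by
  ext i j
  have h : Z j i = Z i j := hZ.apply i j
  simp only [Matrix.sub_apply, conjTranspose_apply, h, Matrix.smul_apply, map_apply, smul_eq_mul]
  rw [Complex.star_def, Complex.sub_conj]
  push_cast
  ring

lemma conjTranspose_map_intCast (A : Matrix (Fin g) (Fin g) ℤ) :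
    (A.map (Int.cast : ℤ → ℂ))ᴴ = (A.map (Int.cast : ℤ → ℂ))ᵀ := by
  ext i j
  simp

variable {A B C D : Matrix (Fin g) (Fin g) ℤ}

lemma symplectic_block_relations_map {S : Type*} [CommRing S]
    (h : fromBlocks A B C D ∈ symplecticGroup (Fin g) ℤ) :
    fromBlocks (A.map (Int.cast : ℤ → S)) (B.map (Int.cast : ℤ → S)) (C.map (Int.cast : ℤ → S))
      (D.map (Int.cast : ℤ → S)) ∈ symplecticGroup (Fin g) S := by
  have := SymplecticGroup.map_mem h (Int.castRingHom S)
  rwa [fromBlocks_map] at this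

lemma siegelDenom_transpose_mul (h : fromBlocks A B C D ∈ symplecticGroup (Fin g) ℤ)
    {Z : Matrix (Fin g) (Fin g) ℂ} (hZ : Z.IsSymm) :
    (siegelDenom C D Z)ᵀ * siegelDenom A B Z = (siegelDenom A B Z)ᵀ * siegelDenom C D Z := by
  obtain ⟨h1, h2, h3, -, -⟩ := symplectic_block_relations (symplectic_block_relations_map (S := ℂ) h)
  have h3' := congrArg transpose h3
  simp only [transpose_sub, transpose_mul, transpose_transpose, transpose_one] at h3'
  have hZ' : Zᵀ = Z := hZ
  simp only [siegelDenom, transpose_add, transpose_mul, hZ', Matrix.add_mul, Matrix.mul_add]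
  generalize A.map (Int.cast : ℤ → ℂ) = a at *
  generalize B.map (Int.cast : ℤ → ℂ) = b at *
  generalize C.map (Int.cast : ℤ → ℂ) = c at *
  generalize D.map (Int.cast : ℤ → ℂ) = d at *
  have e1 : Z * aᵀ * (c * Z) = Z * cᵀ * (a * Z) := by
    rw [Matrix.mul_assoc, ← Matrix.mul_assoc aᵀ, h1]; simp only [Matrix.mul_assoc]
  have e2 : Z * aᵀ * d = Z * cᵀ * b + Z := by
    rw [Matrix.mul_assoc, sub_eq_iff_eq_add.1 h3, Matrix.mul_add, Matrix.mul_one,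
      ← Matrix.mul_assoc, add_comm]
  have e3 : dᵀ * (a * Z) = bᵀ * (c * Z) + Z := by
    rw [← Matrix.mul_assoc, sub_eq_iff_eq_add.1 h3', Matrix.add_mul, Matrix.one_mul,
      ← Matrix.mul_assoc, add_comm]
  rw [e1, e2, e3, h2]
  abel

lemma siegelDenom_conjTranspose_mul_sub (h : fromBlocks A B C D ∈ symplecticGroup (Fin g) ℤ)
    (Z : Matrix (Fin g) (Fin g) ℂ) :
    (siegelDenom C D Z)ᴴ * siegelDenom A B Z - (siegelDenom A B Z)ᴴ * siegelDenom C D Z =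
      Z - Zᴴ := by
  obtain ⟨h1, h2, h3, -, -⟩ := symplectic_block_relations (symplectic_block_relations_map (S := ℂ) h)
  have h3' := congrArg transpose h3
  simp only [transpose_sub, transpose_mul, transpose_transpose, transpose_one] at h3'
  simp only [siegelDenom, conjTranspose_add, conjTranspose_mul, conjTranspose_map_intCast,
    Matrix.add_mul, Matrix.mul_add]
  generalize A.map (Int.cast : ℤ → ℂ) = a at *
  generalize B.map (Int.cast : ℤ → ℂ) = b at *
  generalize C.map (Int.cast : ℤ → ℂ) = c at *
  generalize D.map (Int.cast : ℤ → ℂ) = d at *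
  have e1 : Zᴴ * aᵀ * (c * Z) = Zᴴ * cᵀ * (a * Z) := by
    rw [Matrix.mul_assoc, ← Matrix.mul_assoc aᵀ, h1]; simp only [Matrix.mul_assoc]
  have e2 : Zᴴ * aᵀ * d = Zᴴ * cᵀ * b + Zᴴ := by
    rw [Matrix.mul_assoc, sub_eq_iff_eq_add.1 h3, Matrix.mul_add, Matrix.mul_one,
      ← Matrix.mul_assoc, add_comm]
  have e3 : dᵀ * (a * Z) = bᵀ * (c * Z) + Z := by
    rw [← Matrix.mul_assoc, sub_eq_iff_eq_add.1 h3', Matrix.add_mul, Matrix.one_mul,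
      ← Matrix.mul_assoc, add_comm]
  rw [e1, e2, e3, h2]
  abel

lemma isUnit_det_siegelDenom (h : fromBlocks A B C D ∈ symplecticGroup (Fin g) ℤ)
    {Z : Matrix (Fin g) (Fin g) ℂ} (hZ : Z ∈ SiegelUpperHalf g) :
    IsUnit (siegelDenom C D Z).det := by
  rw [← Matrix.isUnit_iff_isUnit_det, ← mulVec_injective_iff_isUnit]
  rw [← Matrix.coe_mulVecLin, ← LinearMap.ker_eq_bot, LinearMap.ker_eq_bot']
  intro v hv
  rw [Matrix.mulVecLin_apply] at hv
  by_contra hv0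
  have h1 := (posDef_map_ofReal_iff.2 hZ.2).dotProduct_mulVec_pos hv0
  have h2 := siegelDenom_conjTranspose_mul_sub h Z
  rw [sub_conjTranspose_of_isSymm hZ.1] at h2
  have h3 := congrArg (fun M => star v ⬝ᵥ (M *ᵥ v)) h2
  have h4 : star v ᵥ* (siegelDenom C D Z)ᴴ = 0 := by
    rw [← star_mulVec, hv, star_zero]
  simp only [sub_mulVec, ← mulVec_mulVec, hv, mulVec_zero, sub_zero, smul_mulVec,
    dotProduct_smul] at h3
  rw [dotProduct_mulVec, h4, zero_dotProduct, smul_eq_mul, eq_comm, mul_eq_zero] at h3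
  rcases h3 with h3 | h3
  · simp at h3
  · exact h1.ne' h3

lemma siegelAct_isSymm (h : fromBlocks A B C D ∈ symplecticGroup (Fin g) ℤ)
    {Z : Matrix (Fin g) (Fin g) ℂ} (hZ : Z ∈ SiegelUpperHalf g) :
    (siegelAct A B C D Z).IsSymm := by
  have hu := isUnit_det_siegelDenom h hZ
  have huT : IsUnit (siegelDenom C D Z)ᵀ.det := by rwa [det_transpose]
  have h1 := siegelDenom_transpose_mul h hZ.1
  unfold siegelAct Matrix.IsSymm
  rw [transpose_mul, transpose_nonsing_inv]
  have h2 := congrArg (fun M => (siegelDenom C D Z)ᵀ⁻¹ * M * (siegelDenom C D Z)⁻¹) h1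
  rw [nonsing_inv_mul_cancel_left _ _ huT, Matrix.mul_assoc, Matrix.mul_assoc,
    mul_nonsing_inv _ hu, Matrix.mul_one] at h2
  exact h2.symm

lemma conjTranspose_mul_im_siegelAct_mul (h : fromBlocks A B C D ∈ symplecticGroup (Fin g) ℤ)
    {Z : Matrix (Fin g) (Fin g) ℂ} (hZ : Z ∈ SiegelUpperHalf g) :
    (siegelDenom C D Z)ᴴ * ((siegelAct A B C D Z).map Complex.im).map Complex.ofReal *
      siegelDenom C D Z = (Z.map Complex.im).map Complex.ofReal := by
  have hu := isUnit_det_siegelDenom h hZ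
  have huT : IsUnit (siegelDenom C D Z)ᴴ.det := by rw [det_conjTranspose]; exact hu.star
  have h1 := siegelDenom_conjTranspose_mul_sub h Z
  have h2 := sub_conjTranspose_of_isSymm (siegelAct_isSymm h hZ)
  rw [sub_conjTranspose_of_isSymm hZ.1] at h1
  have h3 : (siegelDenom C D Z)ᴴ * (siegelAct A B C D Z - (siegelAct A B C D Z)ᴴ) *
      siegelDenom C D Z = (siegelDenom C D Z)ᴴ * siegelDenom A B Z -
        (siegelDenom A B Z)ᴴ * siegelDenom C D Z := by
    unfold siegelAct
    rw [Matrix.mul_sub, Matrix.sub_mul, Matrix.mul_assoc, nonsing_inv_mul_cancel_right _ _ hu,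
      conjTranspose_mul, conjTranspose_nonsing_inv, mul_nonsing_inv_cancel_left _ _ huT]
  rw [h1, h2, Matrix.mul_smul, Matrix.smul_mul] at h3
  exact smul_right_injective _ (show (2 * I : ℂ) ≠ 0 by simp) h3

lemma siegelAct_mem (h : fromBlocks A B C D ∈ symplecticGroup (Fin g) ℤ)
    {Z : Matrix (Fin g) (Fin g) ℂ} (hZ : Z ∈ SiegelUpperHalf g) :
    siegelAct A B C D Z ∈ SiegelUpperHalf g := by
  refine ⟨siegelAct_isSymm h hZ, ?_⟩
  have hu := isUnit_det_siegelDenom h hZ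
  rw [← Matrix.isUnit_iff_isUnit_det] at hu
  rw [← posDef_map_ofReal_iff, ← IsUnit.posDef_star_left_conjugate_iff hu, star_eq_conjTranspose,
    conjTranspose_mul_im_siegelAct_mul h hZ, posDef_map_ofReal_iff]
  exact hZ.2

lemma det_map_ofReal (M : Matrix (Fin g) (Fin g) ℝ) :
    (M.map Complex.ofReal).det = ((M.det : ℝ) : ℂ) :=
  (RingHom.map_det Complex.ofRealHom M).symm

lemma norm_sq_det_mul_det_im_siegelAct (h : fromBlocks A B C D ∈ symplecticGroup (Fin g) ℤ)
    {Z : Matrix (Fin g) (Fin g) ℂ} (hZ : Z ∈ SiegelUpperHalf g) :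
    ‖(siegelDenom C D Z).det‖ ^ 2 * ((siegelAct A B C D Z).map Complex.im).det =
      (Z.map Complex.im).det := by
  have h1 := congrArg Matrix.det (conjTranspose_mul_im_siegelAct_mul h hZ)
  rw [det_mul, det_mul, det_conjTranspose, det_map_ofReal, det_map_ofReal, mul_right_comm,
    Complex.star_def, ← Complex.normSq_eq_conj_mul_self, Complex.normSq_eq_norm_sq] at h1
  exact_mod_cast h1

lemma map_ofReal_mul (M N : Matrix (Fin g) (Fin g) ℝ) :
    (M * N).map Complex.ofReal = M.map Complex.ofReal * N.map Complex.ofReal :=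
  Matrix.map_mul (f := Complex.ofRealHom)

lemma map_ofReal_inv (M : Matrix (Fin g) (Fin g) ℝ) (hM : IsUnit M.det) :
    M⁻¹.map Complex.ofReal = (M.map Complex.ofReal)⁻¹ := by
  symm
  apply inv_eq_right_inv
  rw [← map_ofReal_mul, mul_nonsing_inv _ hM]
  exact Matrix.map_one _ Complex.ofReal_zero Complex.ofReal_one

lemma imInv_siegelAct (h : fromBlocks A B C D ∈ symplecticGroup (Fin g) ℤ)
    {Z : Matrix (Fin g) (Fin g) ℂ} (hZ : Z ∈ SiegelUpperHalf g) :
    imInv (siegelAct A B C D Z) =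
      (C.map (Int.cast : ℤ → ℝ) * Z.map Complex.re + D.map (Int.cast : ℤ → ℝ)) * imInv Z *
        (C.map (Int.cast : ℤ → ℝ) * Z.map Complex.re + D.map (Int.cast : ℤ → ℝ))ᵀ +
      C.map (Int.cast : ℤ → ℝ) * Z.map Complex.im * (C.map (Int.cast : ℤ → ℝ))ᵀ := by
  have hu := isUnit_det_siegelDenom h hZ
  have hY := hZ.2.det_pos
  have hYu : IsUnit (Z.map Complex.im).det := isUnit_iff_ne_zero.2 hY.ne'
  have hYu' : IsUnit ((siegelAct A B C D Z).map Complex.im).det :=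
    isUnit_iff_ne_zero.2 (siegelAct_mem h hZ).2.det_pos.ne'
  obtain ⟨-, -, -, h4, -⟩ := symplectic_block_relations (symplectic_block_relations_map (S := ℝ) h)
  have hX : (Z.map Complex.re)ᵀ = Z.map Complex.re := by
    ext i j
    simp [hZ.1.apply i j]
  have hYs : (Z.map Complex.im)ᵀ = Z.map Complex.im := by
    ext i j
    simp [hZ.1.apply i j]
  set c := C.map (Int.cast : ℤ → ℝ)
  set d := D.map (Int.cast : ℤ → ℝ)
  set X := Z.map Complex.re
  set Y := Z.map Complex.im
  have hN : siegelDenom C D Z = (c * X + d).map Complex.ofReal +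
      I • (c * Y).map Complex.ofReal := by
    ext i j
    simp only [siegelDenom, Matrix.add_apply, Matrix.mul_apply, map_apply, Matrix.smul_apply, smul_eq_mul, c, d, X, Y]
    push_cast
    rw [Finset.mul_sum, add_right_comm, ← Finset.sum_add_distrib]
    congr 1
    refine Finset.sum_congr rfl fun k _ => ?_
    conv_lhs => rw [← Complex.re_add_im (Z k j)]
    ring
  have hNH : (siegelDenom C D Z)ᴴ = (c * X + d)ᵀ.map Complex.ofReal -
      I • (c * Y)ᵀ.map Complex.ofReal := by
    rw [hN]
    ext i j
    simp only [conjTranspose_apply, transpose_apply, Matrix.add_apply, Matrix.sub_apply, map_apply,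
      Matrix.smul_apply, smul_eq_mul, star_add, star_mul', Complex.star_def, Complex.conj_I,
      Complex.conj_ofReal]
    ring
  have h1 := congrArg (fun M => M⁻¹) (conjTranspose_mul_im_siegelAct_mul h hZ)
  simp only [Matrix.mul_inv_rev] at h1
  rw [← map_ofReal_inv _ hYu, ← map_ofReal_inv _ hYu'] at h1
  have h2 : (imInv (siegelAct A B C D Z)).map Complex.ofReal =
      siegelDenom C D Z * (imInv Z).map Complex.ofReal * (siegelDenom C D Z)ᴴ := by
    have huT : IsUnit (siegelDenom C D Z)ᴴ.det := by rw [det_conjTranspose]; exact hu.star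
    unfold imInv
    rw [← h1, mul_nonsing_inv_cancel_left _ _ hu, Matrix.mul_assoc, nonsing_inv_mul _ huT,
      Matrix.mul_one]
  rw [hNH, hN] at h2
  have hYW : Y * imInv Z = 1 := mul_nonsing_inv _ hYu
  have hWY : imInv Z * Y = 1 := nonsing_inv_mul _ hYu
  have e : c * (c * X + d)ᵀ = (c * X + d) * cᵀ := by
    rw [transpose_add, transpose_mul, hX, Matrix.mul_add, Matrix.add_mul, h4, Matrix.mul_assoc]
  have e1 : c * Y * imInv Z * (c * X + d)ᵀ = (c * X + d) * imInv Z * (c * Y)ᵀ := by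
    rw [Matrix.mul_assoc c, hYW, Matrix.mul_one, transpose_mul, hYs, Matrix.mul_assoc _ (imInv Z),
      ← Matrix.mul_assoc (imInv Z), hWY, Matrix.one_mul, e]
  have e2 : c * Y * imInv Z * (c * Y)ᵀ = c * Y * cᵀ := by
    rw [Matrix.mul_assoc c, hYW, Matrix.mul_one, transpose_mul, hYs, Matrix.mul_assoc]
  have h3 : (imInv (siegelAct A B C D Z)).map Complex.ofReal =
      ((c * X + d) * imInv Z * (c * X + d)ᵀ + c * Y * cᵀ).map Complex.ofReal := by
    rw [h2, ← e2]
    clear_value c d X Y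
    generalize c * X + d = r at *
    generalize c * Y = v at *
    have e1' := congrArg (fun M => M.map Complex.ofReal) e1
    simp only [map_ofReal_mul] at e1'
    rw [Matrix.map_add _ Complex.ofReal_add]
    simp only [map_ofReal_mul, Matrix.add_mul, Matrix.mul_sub, Matrix.mul_smul, Matrix.smul_mul]
      at e1' ⊢
    rw [e1']
    match_scalars <;> simp
  ext i j
  have := congrFun (congrFun h3 i) j
  simpa only [map_apply, Complex.ofReal_inj] using this

end SymplecticAction

section LeadingMinors

variable {g : ℕ}

/-- The matrix agreeing with `M` on the leading `p × p` block and with the identity elsewhere. -/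
def leadingMask {R : Type*} [Zero R] [One R] (p : ℕ) (M : Matrix (Fin g) (Fin g) R) :
    Matrix (Fin g) (Fin g) R :=
  Matrix.of fun a b => if a.val < p ∧ b.val < p then M a b else if a = b then 1 else 0

/-- The leading principal minor of size `p`. -/
def leadingMinor {R : Type*} [CommRing R] (p : ℕ) (M : Matrix (Fin g) (Fin g) R) : R :=
  (leadingMask p M).det

lemma leadingMinor_congr {R : Type*} [CommRing R] {p : ℕ} {M N : Matrix (Fin g) (Fin g) R}
    (h : ∀ a b : Fin g, a.val < p → b.val < p → M a b = N a b) :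
    leadingMinor p M = leadingMinor p N := by
  unfold leadingMinor
  congr 1
  ext a b
  simp only [leadingMask, of_apply]
  split_ifs with h1
  · exact h a b h1.1 h1.2
  · rfl
  · rfl

lemma leadingMinor_of_le {R : Type*} [CommRing R] {p : ℕ} (hp : g ≤ p)
    (M : Matrix (Fin g) (Fin g) R) : leadingMinor p M = M.det := by
  unfold leadingMinor
  congr 1
  ext a b
  simp [leadingMask, a.2.trans_le hp, b.2.trans_le hp]

/-- Lower triangular with unit diagonal. -/
def IsLowerUnitriangular {R : Type*} [Zero R] [One R] (L : Matrix (Fin g) (Fin g) R) : Prop :=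
  (∀ a b, a < b → L a b = 0) ∧ ∀ a, L a a = 1

lemma IsLowerUnitriangular.det_eq_one {R : Type*} [CommRing R] {L : Matrix (Fin g) (Fin g) R}
    (hL : IsLowerUnitriangular L) : L.det = 1 := by
  rw [det_of_isLowerTriangular L (fun a b hab => hL.1 a b hab)]
  simp [hL.2]

lemma IsLowerUnitriangular.leadingMask {R : Type*} [Zero R] [One R]
    {L : Matrix (Fin g) (Fin g) R} (hL : IsLowerUnitriangular L) (p : ℕ) :
    IsLowerUnitriangular (leadingMask p L) := by
  constructor
  · intro a b hab
    simp [_root_.leadingMask, hL.1 a b hab, hab.ne]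
  · intro a
    simp [_root_.leadingMask, hL.2 a]

lemma IsLowerUnitriangular.mul {R : Type*} [CommRing R] {L N : Matrix (Fin g) (Fin g) R}
    (hL : IsLowerUnitriangular L) (hN : IsLowerUnitriangular N) :
    IsLowerUnitriangular (L * N) := by
  constructor
  · intro a b hab
    rw [Matrix.mul_apply]
    refine Finset.sum_eq_zero fun j _ => ?_
    rcases lt_or_ge a j with h | h
    · rw [hL.1 a j h, zero_mul]
    · rw [hN.1 j b (h.trans_lt hab), mul_zero]
  · intro a
    rw [Matrix.mul_apply, Finset.sum_eq_single a]
    · rw [hL.2, hN.2, mul_one]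
    · intro j _ hj
      rcases lt_or_gt_of_ne hj with h | h
      · rw [hN.1 j a h, mul_zero]
      · rw [hL.1 a j h, zero_mul]
    · simp

lemma mul_diagonal_mul_transpose_apply {R : Type*} [CommRing R] (L : Matrix (Fin g) (Fin g) R)
    (e : Fin g → R) (a b : Fin g) :
    (L * diagonal e * Lᵀ) a b = ∑ j, L a j * e j * L b j := by
  rw [Matrix.mul_apply]
  simp only [mul_diagonal, transpose_apply]

lemma leadingMinor_mul_diagonal_mul_transpose {L : Matrix (Fin g) (Fin g) ℝ}
    (hL : IsLowerUnitriangular L) (e : Fin g → ℝ) (p : ℕ) :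
    leadingMinor p (L * diagonal e * Lᵀ) = ∏ j : Fin g, if j.val < p then e j else 1 := by
  have h : leadingMask p (L * diagonal e * Lᵀ) =
      leadingMask p L * diagonal (fun j : Fin g => if j.val < p then e j else 1) *
        (leadingMask p L)ᵀ := by
    ext a b
    rw [mul_diagonal_mul_transpose_apply (leadingMask p L)]
    by_cases ha : a.val < p
    · by_cases hb : b.val < p
      · simp only [leadingMask, of_apply, mul_diagonal_mul_transpose_apply, ha, hb, and_self,
          if_true, true_and]
        refine Finset.sum_congr rfl fun j _ => ?_
        by_cases hj : j.val < p
        · simp [hj]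
        · have h1 : a < j := Fin.lt_def.2 (by omega)
          simp [hj, hL.1 a j h1, h1.ne]
      · symm
        rw [Finset.sum_eq_single b]
        · have : a ≠ b := fun h => hb (h ▸ ha)
          simp [leadingMask, hb, this]
        · intro j _ hj
          simp [leadingMask, hb, hj.symm]
        · simp
    · symm
      rw [Finset.sum_eq_single a]
      · by_cases hab : a = b
        · subst hab; simp [leadingMask, ha]
        · simp [leadingMask, ha, hab, Ne.symm hab]
      · intro j _ hj
        simp [leadingMask, ha, hj.symm]
      · simp
  unfold leadingMinor
  rw [h, det_mul, det_mul, det_transpose, (hL.leadingMask p).det_eq_one, det_diagonal]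
  ring

lemma Matrix.PosDef.exists_ldl {W : Matrix (Fin g) (Fin g) ℝ} (hW : W.PosDef) :
    ∃ (L : Matrix (Fin g) (Fin g) ℝ) (e : Fin g → ℝ), IsLowerUnitriangular L ∧ (∀ i, 0 < e i) ∧
      W = L * diagonal e * Lᵀ := by
  have h1 := LDL.lower_conj_diag hW
  have htri : (LDL.lowerInv hW).BlockTriangular OrderDual.toDual :=
    fun a b hab => LDL.lowerInv_triangular hW hab
  have htri2 : (LDL.lower hW).BlockTriangular OrderDual.toDual :=
    blockTriangular_inv_of_blockTriangular htri
  set M := LDL.lower hW with hM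
  have hM0 : ∀ i, M i i ≠ 0 := by
    have h2 : M.det ≠ 0 := by
      intro h0
      have h3 := hW.det_pos
      rw [← h1, det_mul, det_mul, h0] at h3
      simp at h3
    rw [det_of_isLowerTriangular M htri2, Finset.prod_ne_zero_iff] at h2
    exact fun i => h2 i (Finset.mem_univ i)
  set d := LDL.diagEntries hW
  have hL : IsLowerUnitriangular (M * diagonal fun i => (M i i)⁻¹) := by
    constructor
    · intro a b hab
      rw [mul_diagonal, htri2 (show OrderDual.toDual b < OrderDual.toDual a from hab), zero_mul]
    · intro a
      rw [mul_diagonal, mul_inv_cancel₀ (hM0 a)]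
  have hW' : W = (M * diagonal fun i => (M i i)⁻¹) * diagonal (fun i => M i i ^ 2 * d i) *
      (M * diagonal fun i => (M i i)⁻¹)ᵀ := by
    ext a b
    rw [mul_diagonal_mul_transpose_apply]
    conv_lhs => rw [← h1]
    rw [LDL.diag, conjTranspose_eq_transpose_of_trivial, mul_diagonal_mul_transpose_apply]
    refine Finset.sum_congr rfl fun j _ => ?_
    rw [mul_diagonal, mul_diagonal]
    have := hM0 j
    change M a j * d j * M b j = _
    field_simp
  refine ⟨_, _, hL, ?_, hW'⟩
  have hd : (diagonal fun i => M i i ^ 2 * d i).PosDef := by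
    have hu : IsUnit (M * diagonal fun i => (M i i)⁻¹) := by
      rw [Matrix.isUnit_iff_isUnit_det, hL.det_eq_one]
      exact isUnit_one
    rw [← IsUnit.posDef_star_right_conjugate_iff hu, star_eq_conjTranspose,
      conjTranspose_eq_transpose_of_trivial, ← hW']
    exact hW
  exact posDef_diagonal_iff.1 hd

lemma exists_int_combination_abs_le_half {L : Matrix (Fin g) (Fin g) ℝ}
    (hL : IsLowerUnitriangular L) (p : ℕ) (v : Fin g → ℝ) :
    ∃ m : Fin g → ℤ, (∀ k : Fin g, p ≤ k.val → m k = 0) ∧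
      ∀ j : Fin g, j.val < p → |v j + ∑ k, (m k : ℝ) * L k j| ≤ 1 / 2 := by
  induction p generalizing v with
  | zero => exact ⟨0, by simp, by simp⟩
  | succ p ih =>
    by_cases hp : p < g
    · set q : Fin g := ⟨p, hp⟩ with hq
      obtain ⟨m, hm1, hm2⟩ := ih (fun j => v j + (-round (v q) : ℝ) * L q j)
      refine ⟨m + Pi.single q (-round (v q)), ?_, ?_⟩
      · intro k hk
        have hkq : k ≠ q := fun h => by simp [h, hq] at hk
        simp [hm1 k (by omega), hkq]
      · intro j hj
        have hsum : v j + ∑ k, ((m + Pi.single q (-round (v q)) : Fin g → ℤ) k : ℝ) * L k j =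
            v j + (-round (v q) : ℝ) * L q j + ∑ k, (m k : ℝ) * L k j := by
          have : ∀ k, ((m + Pi.single q (-round (v q)) : Fin g → ℤ) k : ℝ) * L k j =
              (m k : ℝ) * L k j + if k = q then (-round (v q) : ℝ) * L q j else 0 := by
            intro k
            by_cases hk : k = q
            · subst hk; simp; ring
            · simp [hk]
          simp only [this, Finset.sum_add_distrib, Finset.sum_ite_eq', Finset.mem_univ, if_true]
          ring
        rw [hsum]
        by_cases hjp : j.val < p
        · exact hm2 j hjp
        · have hjq : j = q := Fin.ext (by simp [hq]; omega)
          subst hjq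
          rw [Finset.sum_eq_zero, hL.2]
          · have := abs_sub_round (v q)
            simpa [sub_eq_add_neg] using this
          · intro k _
            rcases lt_or_ge k q with h | h
            · rw [hL.1 k q h, mul_zero]
            · rw [hm1 k (by simpa [hq] using Fin.le_def.1 h)]
              simp
    · obtain ⟨m, hm1, hm2⟩ := ih v
      exact ⟨m, fun k hk => hm1 k (by omega), fun j _ => hm2 j (by omega)⟩

lemma IsLowerUnitriangular.exists_size_reduced {L : Matrix (Fin g) (Fin g) ℝ}
    (hL : IsLowerUnitriangular L) :
    ∃ N : Matrix (Fin g) (Fin g) ℤ, IsLowerUnitriangular N ∧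
      IsLowerUnitriangular (N.map (Int.cast : ℤ → ℝ) * L) ∧
      ∀ i j, j < i → |(N.map (Int.cast : ℤ → ℝ) * L) i j| ≤ 1 / 2 := by
  choose m hm1 hm2 using fun i : Fin g => exists_int_combination_abs_le_half hL i.val (L i)
  have hN : IsLowerUnitriangular (1 + Matrix.of m) := by
    constructor
    · intro a b hab
      simp [hm1 a b hab.le, hab.ne]
    · intro a
      simp [hm1 a a le_rfl]
  have hN' : IsLowerUnitriangular ((1 + Matrix.of m).map (Int.cast : ℤ → ℝ)) := by
    constructor
    · intro a b hab
      rw [map_apply, hN.1 a b hab, Int.cast_zero]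
    · intro a
      rw [map_apply, hN.2 a, Int.cast_one]
  refine ⟨1 + Matrix.of m, hN, hN'.mul hL, fun i j hij => ?_⟩
  have : ((1 + Matrix.of m).map (Int.cast : ℤ → ℝ) * L) i j = L i j + ∑ k, (m i k : ℝ) * L k j := by
    have h1 : (1 + Matrix.of m).map (Int.cast : ℤ → ℝ) =
        1 + (Matrix.of m).map (Int.cast : ℤ → ℝ) := by
      rw [Matrix.map_add _ Int.cast_add, Matrix.map_one _ Int.cast_zero Int.cast_one]
    rw [h1, Matrix.add_mul, Matrix.one_mul, Matrix.add_apply, Matrix.mul_apply]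
    rfl
  rw [this]
  exact hm2 i j hij

lemma leadingMask_eq {p : ℕ} (M : Matrix (Fin g) (Fin g) ℝ) :
    leadingMask p M = diagonal (fun a : Fin g => if a.val < p then (1 : ℝ) else 0) * M *
      diagonal (fun a : Fin g => if a.val < p then (1 : ℝ) else 0) +
      diagonal (fun a : Fin g => if a.val < p then (0 : ℝ) else 1) := by
  ext a b
  by_cases hab : a = b
  · subst hab
    by_cases ha : a.val < p <;> simp [leadingMask, mul_diagonal, diagonal_mul, ha]
  · by_cases ha : a.val < p <;> by_cases hb : b.val < p <;>
      simp [leadingMask, mul_diagonal, diagonal_mul, ha, hb, hab]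

lemma leadingMask_sub_smul_posSemidef {W G : Matrix (Fin g) (Fin g) ℝ} {μ : ℝ} (hμ1 : μ ≤ 1)
    (h : (W - μ • G).PosSemidef) (p : ℕ) :
    (leadingMask p W - μ • leadingMask p G).PosSemidef := by
  have h1 := h.mul_mul_conjTranspose_same
    (diagonal (fun a : Fin g => if a.val < p then (1 : ℝ) else 0))
  rw [conjTranspose_eq_transpose_of_trivial, diagonal_transpose] at h1
  have h2 : (diagonal (fun a : Fin g => if a.val < p then (0 : ℝ) else 1)).PosSemidef :=
    PosSemidef.diagonal fun i => by
      simp only [Pi.zero_apply]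
      split_ifs <;> norm_num
  convert h1.add (h2.smul (sub_nonneg.2 hμ1)) using 1
  rw [leadingMask_eq, leadingMask_eq, Matrix.mul_sub, Matrix.sub_mul, Matrix.mul_smul,
    Matrix.smul_mul]
  module

lemma Matrix.PosDef.exists_pos_sub_smul_one {M : Matrix (Fin g) (Fin g) ℝ} (hM : M.PosDef) :
    ∃ μ : ℝ, 0 < μ ∧ μ ≤ 1 ∧ (M - μ • (1 : Matrix (Fin g) (Fin g) ℝ)).PosSemidef := by
  have h1 := hM.inv.posSemidef.trace_nonneg
  have h := hM.inv.inv_sub_inv_trace (t := M⁻¹.trace + 1) (by linarith) (by linarith)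
  rw [nonsing_inv_nonsing_inv _ (isUnit_iff_ne_zero.2 hM.det_pos.ne')] at h
  exact ⟨_, by positivity, inv_le_one_of_one_le₀ (by linarith), h⟩

lemma Matrix.PosDef.leadingMask {M : Matrix (Fin g) (Fin g) ℝ} (hM : M.PosDef) (p : ℕ) :
    (leadingMask p M).PosDef := by
  obtain ⟨μ, h0, h1, h⟩ := hM.exists_pos_sub_smul_one
  have h2 := leadingMask_sub_smul_posSemidef h1 h p
  have h3 : _root_.leadingMask p (1 : Matrix (Fin g) (Fin g) ℝ) = 1 := by
    ext a b
    simp only [_root_.leadingMask, of_apply, one_apply]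
    split_ifs <;> rfl
  rw [h3] at h2
  simpa using PosDef.posSemidef_add h2 ((PosDef.one (n := Fin g) (R := ℝ)).smul h0)

end LeadingMinors

section OrbitLowerBound

variable {g : ℕ}

lemma mul_transpose_posSemidef (M : Matrix (Fin g) (Fin g) ℝ) : (M * Mᵀ).PosSemidef := by
  simpa using posSemidef_self_mul_conjTranspose M

lemma Matrix.PosSemidef.conj_transpose {M : Matrix (Fin g) (Fin g) ℝ} (hM : M.PosSemidef)
    (V : Matrix (Fin g) (Fin g) ℝ) : (V * M * Vᵀ).PosSemidef := by
  simpa using hM.mul_mul_conjTranspose_same V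

lemma sub_smul_gram_posSemidef {W Y : Matrix (Fin g) (Fin g) ℝ} {ν : ℝ} (hν : 0 < ν)
    (hW : (W - ν • (1 : Matrix (Fin g) (Fin g) ℝ)).PosSemidef)
    (hY : (Y - ν • (1 : Matrix (Fin g) (Fin g) ℝ)).PosSemidef)
    (X C D : Matrix (Fin g) (Fin g) ℝ) :
    ((C * X + D) * W * (C * X + D)ᵀ + C * Y * Cᵀ -
      (ν / (3 + 2 * (X * Xᵀ).trace)) • (C * Cᵀ + D * Dᵀ)).PosSemidef := by
  have hX := mul_transpose_posSemidef X
  have hτ := hX.trace_nonneg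
  set τ := (X * Xᵀ).trace with hτ'
  have h1 := hX.trace_smul_one_sub
  rw [← hτ'] at h1
  have h2 := (((mul_transpose_posSemidef (C * X + D + C * X)).add
    ((h1.conj_transpose C).smul (zero_le_two (α := ℝ)))).add
    ((mul_transpose_posSemidef (C * X + D)).smul (show (0 : ℝ) ≤ 1 + 2 * τ by positivity))).add
    ((mul_transpose_posSemidef C).smul (zero_le_two (α := ℝ)))
  have hs : (0 : ℝ) < 3 + 2 * τ := by positivity
  have h3 := ((hW.conj_transpose (C * X + D)).add (hY.conj_transpose C)).add
    (h2.smul (div_pos hν hs).le)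
  convert h3 using 1
  have hc : ν = (ν / (3 + 2 * τ)) * (3 + 2 * τ) := by field_simp
  set c := ν / (3 + 2 * τ)
  rw [hc]
  simp only [Matrix.mul_sub, Matrix.sub_mul, Matrix.mul_smul, Matrix.smul_mul, Matrix.mul_one,
    transpose_add, transpose_mul, Matrix.add_mul, Matrix.mul_add, Matrix.mul_assoc]
  module

lemma gram_posDef {A B C D : Matrix (Fin g) (Fin g) ℝ} (h : A * Dᵀ - B * Cᵀ = 1) :
    (C * Cᵀ + D * Dᵀ).PosDef := by
  refine PosDef.of_dotProduct_mulVec_pos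
    ((mul_transpose_posSemidef C).add (mul_transpose_posSemidef D)).1 fun x hx => ?_
  have h1 : star x ⬝ᵥ ((C * Cᵀ + D * Dᵀ) *ᵥ x) =
      (Cᵀ *ᵥ x) ⬝ᵥ (Cᵀ *ᵥ x) + (Dᵀ *ᵥ x) ⬝ᵥ (Dᵀ *ᵥ x) := by
    rw [add_mulVec, dotProduct_add, ← mulVec_mulVec, ← mulVec_mulVec, star_trivial,
      dotProduct_mulVec x C, dotProduct_mulVec x D, ← mulVec_transpose, ← mulVec_transpose]
  rw [h1]
  have hc : 0 ≤ (Cᵀ *ᵥ x) ⬝ᵥ (Cᵀ *ᵥ x) := Finset.sum_nonneg fun i _ => mul_self_nonneg _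
  have hd : 0 ≤ (Dᵀ *ᵥ x) ⬝ᵥ (Dᵀ *ᵥ x) := Finset.sum_nonneg fun i _ => mul_self_nonneg _
  refine lt_of_le_of_ne (by positivity) fun h0 => hx ?_
  have hc0 : Cᵀ *ᵥ x = 0 := dotProduct_self_eq_zero.1 (by linarith)
  have hd0 : Dᵀ *ᵥ x = 0 := dotProduct_self_eq_zero.1 (by linarith)
  rw [← one_mulVec x, ← h, sub_mulVec, ← mulVec_mulVec, ← mulVec_mulVec, hc0, hd0]
  simp

lemma leadingMinor_map_intCast (p : ℕ) (G : Matrix (Fin g) (Fin g) ℤ) :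
    leadingMinor p (G.map (Int.cast : ℤ → ℝ)) = ((leadingMinor p G : ℤ) : ℝ) := by
  unfold leadingMinor
  have h := RingHom.map_det (Int.castRingHom ℝ) (leadingMask p G)
  refine Eq.trans ?_ h.symm
  congr 1
  ext a b
  simp only [leadingMask, of_apply, map_apply, RingHom.mapMatrix_apply, Int.coe_castRingHom]
  split_ifs <;> simp

lemma exists_pos_le_leadingMinor {Z : Matrix (Fin g) (Fin g) ℂ} (hZ : Z ∈ SiegelUpperHalf g) :
    ∃ c : ℝ, 0 < c ∧ ∀ A B C D : Matrix (Fin g) (Fin g) ℤ,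
      fromBlocks A B C D ∈ symplecticGroup (Fin g) ℤ →
      ∀ p, c ≤ leadingMinor p (imInv (siegelAct A B C D Z)) := by
  obtain ⟨μ₁, h10, h11, h1⟩ := (imInv_posDef hZ).exists_pos_sub_smul_one
  obtain ⟨μ₂, h20, h21, h2⟩ := hZ.2.exists_pos_sub_smul_one
  have key : ∀ {M : Matrix (Fin g) (Fin g) ℝ} {μ ν : ℝ}, ν ≤ μ →
      (M - μ • (1 : Matrix (Fin g) (Fin g) ℝ)).PosSemidef →
      (M - ν • (1 : Matrix (Fin g) (Fin g) ℝ)).PosSemidef := by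
    intro M μ ν hle hM
    have := hM.add ((PosSemidef.one (n := Fin g) (R := ℝ)).smul (sub_nonneg.2 hle))
    convert this using 1
    module
  set ν := min μ₁ μ₂
  have hν : 0 < ν := lt_min h10 h20
  have hν1 : ν ≤ 1 := (min_le_left _ _).trans h11
  set X := Z.map Complex.re
  have hτ := (mul_transpose_posSemidef X).trace_nonneg
  set μ := ν / (3 + 2 * (X * Xᵀ).trace) with hμ
  have hμ0 : 0 < μ := by positivity
  have hμ1 : μ ≤ 1 := (div_le_one (by positivity)).2 (by linarith)
  refine ⟨μ ^ g, by positivity, fun A B C D h p => ?_⟩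
  have h3 := sub_smul_gram_posSemidef hν (key (min_le_left _ _) h1) (key (min_le_right _ _) h2) X
    (C.map (Int.cast : ℤ → ℝ)) (D.map (Int.cast : ℤ → ℝ))
  rw [← imInv_siegelAct h hZ, ← hμ] at h3
  have h4 := leadingMask_sub_smul_posSemidef hμ1 h3 p
  obtain ⟨-, -, -, -, h5⟩ := symplectic_block_relations (symplectic_block_relations_map (S := ℝ) h)
  have hG := (gram_posDef h5).leadingMask p
  have h6 := det_le_det_of_sub_posSemidef (hG.smul hμ0) h4
  have h7 : C.map (Int.cast : ℤ → ℝ) * (C.map (Int.cast : ℤ → ℝ))ᵀ +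
      D.map (Int.cast : ℤ → ℝ) * (D.map (Int.cast : ℤ → ℝ))ᵀ =
      (C * Cᵀ + D * Dᵀ).map (Int.cast : ℤ → ℝ) := by
    rw [Matrix.map_add _ Int.cast_add, ← transpose_map, ← transpose_map]
    congr 1 <;> exact (Matrix.map_mul (f := Int.castRingHom ℝ)).symm
  have h8 := hG.det_pos
  rw [h7] at h6 h8
  change 0 < leadingMinor p _ at h8
  rw [det_smul, Fintype.card_fin] at h6
  change μ ^ g * leadingMinor p _ ≤ _ at h6
  rw [leadingMinor_map_intCast] at h6 h8
  have h9 : (1 : ℝ) ≤ ((leadingMinor p (C * Cᵀ + D * Dᵀ) : ℤ) : ℝ) := by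
    exact_mod_cast Int.cast_pos.1 h8
  exact (le_mul_of_one_le_right (by positivity) h9).trans h6

end OrbitLowerBound

section Orbit

variable {g : ℕ}

/-- The second point lies in the `Sp_g(ℤ)`-orbit of the first. -/
def SiegelEquiv (Z Z' : Matrix (Fin g) (Fin g) ℂ) : Prop :=
  ∃ A B C D : Matrix (Fin g) (Fin g) ℤ, fromBlocks A B C D ∈ symplecticGroup (Fin g) ℤ ∧
    Z' = siegelAct A B C D Z

variable {Z Z' Z'' : Matrix (Fin g) (Fin g) ℂ}

lemma SiegelEquiv.mem (h : SiegelEquiv Z Z') (hZ : Z ∈ SiegelUpperHalf g) :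
    Z' ∈ SiegelUpperHalf g := by
  obtain ⟨A, B, C, D, h, rfl⟩ := h
  exact siegelAct_mem h hZ

lemma siegelDenom_mul_siegelDenom (A B C D C' D' : Matrix (Fin g) (Fin g) ℤ)
    (hu : IsUnit (siegelDenom C D Z).det) :
    siegelDenom (C' * A + D' * C) (C' * B + D' * D) Z =
      siegelDenom C' D' (siegelAct A B C D Z) * siegelDenom C D Z := by
  have hm : ∀ M N : Matrix (Fin g) (Fin g) ℤ, (M * N).map (Int.cast : ℤ → ℂ) =
      M.map (Int.cast : ℤ → ℂ) * N.map (Int.cast : ℤ → ℂ) := fun M N =>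
    Matrix.map_mul (f := Int.castRingHom ℂ)
  have h1 : siegelAct A B C D Z * siegelDenom C D Z = siegelDenom A B Z := by
    rw [siegelAct, nonsing_inv_mul_cancel_right _ _ hu]
  rw [siegelDenom.eq_1 C' D', Matrix.add_mul, Matrix.mul_assoc, h1]
  simp only [siegelDenom, Matrix.map_add _ Int.cast_add, hm, Matrix.add_mul, Matrix.mul_add,
    Matrix.mul_assoc]
  abel

lemma SiegelEquiv.trans (hZ : Z ∈ SiegelUpperHalf g) (h : SiegelEquiv Z Z')
    (h' : SiegelEquiv Z' Z'') : SiegelEquiv Z Z'' := by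
  obtain ⟨A, B, C, D, h, rfl⟩ := h
  obtain ⟨A', B', C', D', h', rfl⟩ := h'
  have hu := isUnit_det_siegelDenom h hZ
  have hm := mul_mem h' h
  rw [fromBlocks_multiply] at hm
  refine ⟨_, _, _, _, hm, ?_⟩
  rw [siegelAct.eq_1 A', siegelAct.eq_1 (A' * A + B' * C), siegelDenom_mul_siegelDenom _ _ _ _ _ _ hu,
    siegelDenom_mul_siegelDenom _ _ _ _ _ _ hu, Matrix.mul_inv_rev, Matrix.mul_assoc,
    mul_nonsing_inv_cancel_left _ _ hu]

lemma SiegelEquiv.refl (Z : Matrix (Fin g) (Fin g) ℂ) : SiegelEquiv Z Z := by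
  refine ⟨1, 0, 0, 1, ?_, ?_⟩
  · rw [fromBlocks_one]
    exact one_mem _
  · simp [siegelAct, siegelDenom]

lemma exists_siegelEquiv_conj (hZ : Z ∈ SiegelUpperHalf g) {D D' : Matrix (Fin g) (Fin g) ℤ}
    (hD : D * D' = 1) :
    ∃ Z', SiegelEquiv Z Z' ∧
      imInv Z' = D.map (Int.cast : ℤ → ℝ) * imInv Z * (D.map (Int.cast : ℤ → ℝ))ᵀ := by
  have h : fromBlocks D'ᵀ 0 0 D ∈ symplecticGroup (Fin g) ℤ := by
    have h2 : D'ᵀ * Dᵀ = 1 := by rw [← transpose_mul, hD, transpose_one]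
    rw [SymplecticGroup.mem_iff]
    simp [J, fromBlocks_transpose, fromBlocks_multiply, hD, h2]
  refine ⟨_, ⟨_, _, _, _, h, rfl⟩, ?_⟩
  rw [imInv_siegelAct h hZ]
  simp

lemma siegelEquiv_add_intCast {B : Matrix (Fin g) (Fin g) ℤ} (hB : B.IsSymm) :
    SiegelEquiv Z (Z + B.map (Int.cast : ℤ → ℂ)) := by
  refine ⟨1, B, 0, 1, ?_, ?_⟩
  · rw [SymplecticGroup.mem_iff]
    simp [J, fromBlocks_transpose, fromBlocks_multiply, hB.eq]
  · simp [siegelAct, siegelDenom]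

lemma exists_siegelEquiv_inversion (hZ : Z ∈ SiegelUpperHalf g) (l : Fin g) :
    ∃ Z', SiegelEquiv Z Z' ∧ (∀ a b, a ≠ l → b ≠ l → imInv Z' a b = imInv Z a b) ∧
      (imInv Z').det = ‖Z l l‖ ^ 2 * (imInv Z).det := by
  set E : Matrix (Fin g) (Fin g) ℤ := Matrix.single l l 1 with hE
  have hET : Eᵀ = E := by simp [hE]
  have hEE : E * E = E := by simp [hE]
  have h : fromBlocks (1 - E) (-E) E (1 - E) ∈ symplecticGroup (Fin g) ℤ := by
    rw [SymplecticGroup.mem_iff]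
    simp [J, fromBlocks_transpose, fromBlocks_multiply, hET, Matrix.mul_sub, Matrix.sub_mul, hEE]
    abel
  refine ⟨_, ⟨_, _, _, _, h, rfl⟩, ?_, ?_⟩
  · intro a b ha hb
    set V := E.map (Int.cast : ℤ → ℝ) * Z.map Complex.re + (1 - E).map (Int.cast : ℤ → ℝ) with hV
    have hE0 : ∀ c : Fin g, c ≠ l → ∀ d, E.map (Int.cast : ℤ → ℝ) c d = 0 := by
      intro c hc d
      simp [hE, Matrix.single, hc.symm]
    have hV1 : ∀ c : Fin g, c ≠ l → ∀ d, V c d = (1 : Matrix (Fin g) (Fin g) ℝ) c d := by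
      intro c hc d
      have h1 : (E.map (Int.cast : ℤ → ℝ) * Z.map Complex.re) c d = 0 := by
        rw [Matrix.mul_apply]
        exact Finset.sum_eq_zero fun j _ => by rw [hE0 c hc, zero_mul]
      rw [hV, Matrix.add_apply, h1, zero_add, Matrix.map_sub _ Int.cast_sub, Matrix.sub_apply,
        hE0 c hc, sub_zero, Matrix.map_one _ Int.cast_zero Int.cast_one]
    rw [imInv_siegelAct h hZ, ← hV, Matrix.add_apply]
    have h2 : (E.map (Int.cast : ℤ → ℝ) * Z.map Complex.im * (E.map (Int.cast : ℤ → ℝ))ᵀ) a b =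
        0 := by
      rw [Matrix.mul_apply]
      exact Finset.sum_eq_zero fun j _ => by rw [transpose_apply, hE0 b hb, mul_zero]
    have h3 : (V * imInv Z * Vᵀ) a b =
        ((1 : Matrix (Fin g) (Fin g) ℝ) * imInv Z * (1 : Matrix (Fin g) (Fin g) ℝ)) a b := by
      rw [Matrix.mul_apply, Matrix.mul_apply]
      refine Finset.sum_congr rfl fun j _ => ?_
      rw [transpose_apply, hV1 b hb, Matrix.mul_apply, Matrix.mul_apply,
        one_apply, one_apply]
      simp only [hV1 a ha, eq_comm]
    rw [h2, h3, Matrix.one_mul, Matrix.mul_one, add_zero]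
  · have h1 := norm_sq_det_mul_det_im_siegelAct h hZ
    have h2 : (siegelDenom E (1 - E) Z).det = Z l l := by
      have h3 : siegelDenom E (1 - E) Z = (1 : Matrix (Fin g) (Fin g) ℂ)ᵀ.updateRow l (Z l) := by
        ext a b
        rw [siegelDenom, Matrix.add_apply, Matrix.mul_apply]
        by_cases ha : a = l
        · subst ha
          simp [hE, Matrix.single, Finset.sum_ite_eq, updateRow_self, one_apply]
        · simp [hE, Matrix.single, ha, Ne.symm ha, updateRow_ne, one_apply]
      rw [h3, ← cramer_transpose_apply, transpose_transpose, cramer_one]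
      rfl
    rw [h2] at h1
    have hp := (siegelAct_mem h hZ).2.det_pos
    have hq := hZ.2.det_pos
    simp only [imInv, det_nonsing_inv, Ring.inverse_eq_inv']
    rw [← h1] at hq ⊢
    have : ‖Z l l‖ ≠ 0 := fun h0 => by simp [h0] at hq
    field_simp

end Orbit

section Reduction

variable {g : ℕ} {Z : Matrix (Fin g) (Fin g) ℂ}

/-- The product of the leading principal minors. -/
def minorProduct (W : Matrix (Fin g) (Fin g) ℝ) : ℝ :=
  ∏ p ∈ Finset.range (g + 1), leadingMinor p W

lemma Matrix.PosDef.leadingMinor_pos {W : Matrix (Fin g) (Fin g) ℝ} (hW : W.PosDef) (p : ℕ) :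
    0 < leadingMinor p W := (hW.leadingMask p).det_pos

lemma leadingMinor_le_of_minorProduct_le {W W' : Matrix (Fin g) (Fin g) ℝ} (hW : W.PosDef)
    {ρ : ℝ} (h : minorProduct W ≤ ρ * minorProduct W') {q : ℕ} (hq : q ≤ g)
    (heq : ∀ p, p ≠ q → p ≤ g → leadingMinor p W' = leadingMinor p W) :
    leadingMinor q W ≤ ρ * leadingMinor q W' := by
  have hmem : q ∈ Finset.range (g + 1) := Finset.mem_range.2 (by omega)
  unfold minorProduct at h
  rw [← Finset.mul_prod_erase _ _ hmem, ← Finset.mul_prod_erase _ _ hmem,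
    Finset.prod_congr rfl (fun p hp => heq p (Finset.ne_of_mem_erase hp)
      (Nat.lt_succ_iff.1 (Finset.mem_range.1 (Finset.mem_of_mem_erase hp)))), ← mul_assoc] at h
  exact le_of_mul_le_mul_right h (Finset.prod_pos fun p _ => hW.leadingMinor_pos p)

lemma exists_siegelEquiv_minorProduct_le (hZ : Z ∈ SiegelUpperHalf g) {ρ : ℝ} (hρ : 1 < ρ) :
    ∃ Z', SiegelEquiv Z Z' ∧ ∀ Z'', SiegelEquiv Z Z'' →
      minorProduct (imInv Z') ≤ ρ * minorProduct (imInv Z'') := by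
  obtain ⟨c, hc, hle⟩ := exists_pos_le_leadingMinor hZ
  set S : Set ℝ := {x | ∃ Z', SiegelEquiv Z Z' ∧ x = minorProduct (imInv Z')} with hS
  have hlb : ∀ x ∈ S, c ^ (g + 1) ≤ x := by
    rintro x ⟨_, ⟨A, B, C, D, h, rfl⟩, rfl⟩
    calc c ^ (g + 1) = ∏ _p ∈ Finset.range (g + 1), c := by simp
      _ ≤ _ := Finset.prod_le_prod (fun _ _ => hc.le) fun p _ => hle A B C D h p
  have hne : S.Nonempty := ⟨_, Z, SiegelEquiv.refl Z, rfl⟩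
  have hpos : 0 < sInf S := lt_of_lt_of_le (by positivity) (le_csInf hne hlb)
  obtain ⟨x, ⟨Z', hZ', rfl⟩, hx⟩ := exists_lt_of_csInf_lt hne
    (show sInf S < ρ * sInf S from lt_mul_of_one_lt_left hpos hρ)
  refine ⟨Z', hZ', fun Z'' hZ'' => hx.le.trans ?_⟩
  exact mul_le_mul_of_nonneg_left (csInf_le ⟨_, hlb⟩ ⟨Z'', hZ'', rfl⟩) (by linarith)

lemma exists_size_reduced_siegelEquiv (hZ : Z ∈ SiegelUpperHalf g) {ρ : ℝ} (hρ : 1 < ρ)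
    (l : Fin g) :
    ∃ (Z' : Matrix (Fin g) (Fin g) ℂ) (L : Matrix (Fin g) (Fin g) ℝ) (e : Fin g → ℝ),
      SiegelEquiv Z Z' ∧ IsLowerUnitriangular L ∧ (∀ i, 0 < e i) ∧
      imInv Z' = L * diagonal e * Lᵀ ∧ (∀ i j, j < i → |L i j| ≤ 1 / 2) ∧
      |(Z' l l).re| ≤ 1 / 2 ∧
      ∀ Z'', SiegelEquiv Z Z'' → minorProduct (imInv Z') ≤ ρ * minorProduct (imInv Z'') := by
  obtain ⟨Z₁, h₁, hmin⟩ := exists_siegelEquiv_minorProduct_le hZ hρ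
  have hZ₁ := h₁.mem hZ
  obtain ⟨L, e, hL, he, hW⟩ := (imInv_posDef hZ₁).exists_ldl
  obtain ⟨N, hN, hNL, hNle⟩ := hL.exists_size_reduced
  have hu : IsUnit N.det := by rw [hN.det_eq_one]; exact isUnit_one
  obtain ⟨Z₂, h₂, hW₂⟩ := exists_siegelEquiv_conj hZ₁ (mul_nonsing_inv N hu)
  have hW₂' : imInv Z₂ = (N.map (Int.cast : ℤ → ℝ) * L) * diagonal e *
      (N.map (Int.cast : ℤ → ℝ) * L)ᵀ := by
    rw [hW₂, hW, transpose_mul]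
    simp only [Matrix.mul_assoc]
  have hprod : minorProduct (imInv Z₂) = minorProduct (imInv Z₁) := by
    unfold minorProduct
    rw [hW₂', hW]
    simp only [leadingMinor_mul_diagonal_mul_transpose hNL,
      leadingMinor_mul_diagonal_mul_transpose hL]
  set B : Matrix (Fin g) (Fin g) ℤ := Matrix.single l l (-round (Z₂ l l).re) with hB
  have h₃ : SiegelEquiv Z₂ (Z₂ + B.map (Int.cast : ℤ → ℂ)) :=
    siegelEquiv_add_intCast (by rw [hB]; exact Matrix.transpose_single _ _ _)
  have hW₃ : imInv (Z₂ + B.map (Int.cast : ℤ → ℂ)) = imInv Z₂ := by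
    unfold imInv
    congr 1
    ext a b
    simp
  refine ⟨_, _, e, (h₁.trans hZ h₂).trans hZ h₃, hNL, he, hW₃.trans hW₂', hNle, ?_, ?_⟩
  · have := abs_sub_round (Z₂ l l).re
    simpa [hB, sub_eq_add_neg] using this
  · rw [hW₃, hprod]
    exact hmin

lemma leadingMinor_submatrix_swap {W : Matrix (Fin g) (Fin g) ℝ} {i i' : Fin g}
    (hi : i'.val = i.val + 1) {p : ℕ} (hp : p ≠ i.val + 1) :
    leadingMinor p (W.submatrix (Equiv.swap i i') (Equiv.swap i i')) = leadingMinor p W := by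
  have hσ : ∀ a : Fin g, (Equiv.swap i i' a).val < p ↔ a.val < p := by
    intro a
    rcases eq_or_ne a i with rfl | h1
    · rw [Equiv.swap_apply_left]; omega
    rcases eq_or_ne a i' with rfl | h2
    · rw [Equiv.swap_apply_right]; omega
    rw [Equiv.swap_apply_of_ne_of_ne h1 h2]
  have h : leadingMask p (W.submatrix (Equiv.swap i i') (Equiv.swap i i')) =
      (leadingMask p W).submatrix (Equiv.swap i i') (Equiv.swap i i') := by
    ext a b
    simp [leadingMask, hσ]
  unfold leadingMinor
  rw [h, det_submatrix_equiv_self]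

lemma leadingMinor_succ_submatrix_swap {L : Matrix (Fin g) (Fin g) ℝ} (hL : IsLowerUnitriangular L)
    (e : Fin g → ℝ) {i i' : Fin g} (hi : i'.val = i.val + 1) :
    leadingMinor (i.val + 1)
      ((L * diagonal e * Lᵀ).submatrix (Equiv.swap i i') (Equiv.swap i i')) =
      ∏ j : Fin g, if j.val < i.val + 1 then
        Function.update e i (L i' i ^ 2 * e i + e i') j else 1 := by
  set e' := Function.update e i (L i' i ^ 2 * e i + e i') with he'
  set L' : Matrix (Fin g) (Fin g) ℝ := Matrix.of fun a b =>
    if b < i ∧ a ≤ i then L (Equiv.swap i i' a) b else if a = b then 1 else 0 with hL'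
  have hii : i < i' := Fin.lt_def.2 (by omega)
  have hσ : ∀ a, a < i → Equiv.swap i i' a = a := fun a ha =>
    Equiv.swap_apply_of_ne_of_ne ha.ne (ha.trans hii).ne
  have hLL : IsLowerUnitriangular L' := by
    constructor
    · intro a b hab
      by_cases hb : b < i
      · simp [hL', hb, (hab.trans hb).le, hσ a (hab.trans hb), hL.1 a b hab]
      · simp [hL', hb, hab.ne]
    · intro a
      by_cases ha : a < i
      · simp [hL', ha, ha.le, hσ a ha, hL.2]
      · simp [hL', ha]
  rw [← leadingMinor_mul_diagonal_mul_transpose hLL]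
  have hzero : ∀ a j : Fin g, a < i → ¬ j < i → L a j = 0 ∧ L' a j = 0 := by
    intro a j ha hj
    have haj : a < j := ha.trans_le (not_lt.1 hj)
    exact ⟨hL.1 a j haj, hLL.1 a j haj⟩
  have hterm : ∀ a b j : Fin g, a ≤ i → b ≤ i → j < i →
      L (Equiv.swap i i' a) j * e j * L (Equiv.swap i i' b) j = L' a j * e' j * L' b j := by
    intro a b j ha hb hj
    simp [hL', he', ha, hb, hj, Function.update_of_ne hj.ne]
  refine leadingMinor_congr fun a b ha hb => ?_
  have ha' : a ≤ i := Fin.le_def.2 (by omega)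
  have hb' : b ≤ i := Fin.le_def.2 (by omega)
  rw [submatrix_apply, mul_diagonal_mul_transpose_apply, mul_diagonal_mul_transpose_apply]
  rcases lt_or_eq_of_le ha' with hai | rfl
  · refine Finset.sum_congr rfl fun j _ => ?_
    by_cases hj : j < i
    · exact hterm a b j ha' hb' hj
    · rw [hσ a hai, (hzero a j hai hj).1, (hzero a j hai hj).2]
      simp
  rcases lt_or_eq_of_le hb' with hbi | rfl
  · refine Finset.sum_congr rfl fun j _ => ?_
    by_cases hj : j < a
    · exact hterm a b j ha' hb' hj
    · rw [hσ b hbi, (hzero b j hbi hj).1, (hzero b j hbi hj).2]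
      simp
  have hj : ∀ j : Fin g, L (Equiv.swap b i' b) j * e j * L (Equiv.swap b i' b) j =
      L' b j * e' j * L' b j + ((if j = b then L i' b ^ 2 * e b - e' b else 0) +
        if j = i' then e i' else 0) := by
    intro j
    rcases lt_trichotomy j b with h | rfl | h
    · rw [hterm b b j le_rfl le_rfl h]
      simp [h.ne, (h.trans hii).ne]
    · rw [Equiv.swap_apply_left, hLL.2]
      simp [hii.ne]
      ring
    · rw [Equiv.swap_apply_left, hLL.1 b j h]
      rcases eq_or_ne j i' with rfl | h'
      · simp [hL.2, hii.ne']
      · have : i' < j := lt_of_le_of_ne (Fin.le_def.2 (by rw [Fin.lt_def] at h; omega)) h'.symm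
        simp [hL.1 i' j this, h.ne', h']
  simp only [hj, Finset.sum_add_distrib, Finset.sum_ite_eq', Finset.mem_univ, if_true]
  simp [he']

lemma map_permMatrix_mul_mul (σ : Equiv.Perm (Fin g)) (W : Matrix (Fin g) (Fin g) ℝ) :
    (σ.permMatrix ℤ).map (Int.cast : ℤ → ℝ) * W * ((σ.permMatrix ℤ).map (Int.cast : ℤ → ℝ))ᵀ =
      W.submatrix σ σ := by
  have h : (σ.permMatrix ℤ).map (Int.cast : ℤ → ℝ) = σ.permMatrix ℝ := by
    ext a b
    simp [Equiv.Perm.permMatrix, PEquiv.toMatrix_apply]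
  ext a b
  rw [h, Matrix.mul_apply]
  simp [Equiv.Perm.permMatrix, PEquiv.toMatrix_apply, Matrix.mul_apply]

lemma diag_entry_le_of_minorProduct_le {Z' : Matrix (Fin g) (Fin g) ℂ}
    (hZ : Z' ∈ SiegelUpperHalf g) {L : Matrix (Fin g) (Fin g) ℝ} {e : Fin g → ℝ}
    (hL : IsLowerUnitriangular L) (he : ∀ i, 0 < e i) (hW : imInv Z' = L * diagonal e * Lᵀ)
    (hred : ∀ i j, j < i → |L i j| ≤ 1 / 2) {ρ : ℝ} (hρ : 1 < ρ)
    (hmin : ∀ Z'', SiegelEquiv Z' Z'' → minorProduct (imInv Z') ≤ ρ * minorProduct (imInv Z''))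
    {i i' : Fin g} (hi : i'.val = i.val + 1) : e i ≤ ρ * (e i / 4 + e i') := by
  set σ := Equiv.swap i i'
  have hP : σ.permMatrix ℤ * σ.permMatrix ℤ = 1 := by
    rw [← Matrix.permMatrix_mul, Equiv.swap_mul_self, Matrix.permMatrix_one]
  obtain ⟨Z'', h, hW''⟩ := exists_siegelEquiv_conj hZ hP
  rw [map_permMatrix_mul_mul] at hW''
  have h1 := leadingMinor_le_of_minorProduct_le (imInv_posDef hZ) (hmin Z'' h)
    (q := i.val + 1) (by omega)
    (fun p hp _ => by rw [hW'']; exact leadingMinor_submatrix_swap hi hp)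
  rw [hW'', hW, leadingMinor_succ_submatrix_swap hL e hi, leadingMinor_mul_diagonal_mul_transpose hL,
    ← Finset.mul_prod_erase _ _ (Finset.mem_univ i),
    ← Finset.mul_prod_erase Finset.univ (fun j : Fin g => if j.val < i.val + 1 then
      Function.update e i (L i' i ^ 2 * e i + e i') j else 1) (Finset.mem_univ i)] at h1
  have h2 : ∏ j ∈ Finset.univ.erase i, (if j.val < i.val + 1 then
      Function.update e i (L i' i ^ 2 * e i + e i') j else 1) =
      ∏ j ∈ Finset.univ.erase i, (if j.val < i.val + 1 then e j else 1) :=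
    Finset.prod_congr rfl fun j hj => by rw [Function.update_of_ne (Finset.ne_of_mem_erase hj)]
  rw [h2, ← mul_assoc] at h1
  have h3 := le_of_mul_le_mul_right h1 (Finset.prod_pos fun j _ => by
    split_ifs
    · exact he j
    · exact one_pos)
  simp only [Nat.lt_succ_self, if_true, Function.update_self] at h3
  refine h3.trans (mul_le_mul_of_nonneg_left ?_ (by linarith))
  have h4 : L i' i ^ 2 ≤ 1 / 4 := by
    have := sq_le_sq' (abs_le.1 (hred i' i (Fin.lt_def.2 (by omega)))).1
      (abs_le.1 (hred i' i (Fin.lt_def.2 (by omega)))).2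
    linarith
  nlinarith [he i]

lemma mul_im_last_eq_one {Z' : Matrix (Fin g) (Fin g) ℂ}
    (hZ : Z' ∈ SiegelUpperHalf g) {L : Matrix (Fin g) (Fin g) ℝ} {e : Fin g → ℝ}
    (hL : IsLowerUnitriangular L) (hW : imInv Z' = L * diagonal e * Lᵀ) {l : Fin g}
    (hl : l.val + 1 = g) : e l * (Z' l l).im = 1 := by
  have hu : IsUnit L.det := by rw [hL.det_eq_one]; exact isUnit_one
  have hcol : ∀ a, a ≠ l → L a l = 0 := fun a ha => hL.1 a l
    (lt_of_le_of_ne (Fin.le_def.2 (by omega)) ha)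
  have h1 : L * (diagonal e * (Lᵀ * Z'.map Complex.im)) = 1 := by
    rw [← Matrix.mul_assoc, ← Matrix.mul_assoc, ← hW, imInv,
      nonsing_inv_mul _ (isUnit_iff_ne_zero.2 hZ.2.det_pos.ne')]
  have h2 : diagonal e * (Lᵀ * Z'.map Complex.im) = L⁻¹ := (inv_eq_right_inv h1).symm
  have h3 := congrFun (congrFun h2 l) l
  have h4 := congrFun (congrFun (nonsing_inv_mul L hu) l) l
  rw [Matrix.mul_apply, Finset.sum_eq_single l (fun a _ ha => by rw [hcol a ha, mul_zero])
    (by simp), hL.2, one_apply_eq, mul_one] at h4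
  rw [h4, diagonal_mul, Matrix.mul_apply, Finset.sum_eq_single l
    (fun a _ ha => by rw [transpose_apply, hcol a ha, zero_mul]) (by simp), transpose_apply, hL.2,
    one_mul] at h3
  exact h3

lemma one_le_norm_sq_of_minorProduct_le {Z' : Matrix (Fin g) (Fin g) ℂ}
    (hZ : Z' ∈ SiegelUpperHalf g) {ρ : ℝ}
    (hmin : ∀ Z'', SiegelEquiv Z' Z'' → minorProduct (imInv Z') ≤ ρ * minorProduct (imInv Z''))
    {l : Fin g} (hl : l.val + 1 = g) : 1 ≤ ρ * ‖Z' l l‖ ^ 2 := by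
  obtain ⟨Z'', h, hW, hdet⟩ := exists_siegelEquiv_inversion hZ l
  have h1 := leadingMinor_le_of_minorProduct_le (imInv_posDef hZ) (hmin Z'' h) le_rfl
    (fun p hp hpg => leadingMinor_congr fun a b ha hb => hW a b
      (fun h => by rw [h] at ha; omega) (fun h => by rw [h] at hb; omega))
  rw [leadingMinor_of_le le_rfl, leadingMinor_of_le le_rfl, hdet, ← mul_assoc] at h1
  exact le_of_mul_le_mul_right (by rwa [one_mul]) (imInv_posDef hZ).det_pos

lemma trace_le_of_size_reduced {L : Matrix (Fin g) (Fin g) ℝ} {e : Fin g → ℝ}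
    (hL : IsLowerUnitriangular L) (he : ∀ i, 0 < e i)
    (hred : ∀ i j, j < i → |L i j| ≤ 1 / 2) :
    (L * diagonal e * Lᵀ).trace ≤ ∑ j : Fin g, e j * (1 + ((g - 1 - j.val : ℕ) : ℝ) / 4) := by
  simp only [trace, diag_apply, mul_diagonal_mul_transpose_apply]
  rw [Finset.sum_comm]
  refine Finset.sum_le_sum fun j _ => ?_
  have h1 : ∑ i, L i j * e j * L i j = e j * ∑ i, L i j ^ 2 := by
    rw [Finset.mul_sum]
    exact Finset.sum_congr rfl fun i _ => by ring
  rw [h1]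
  refine mul_le_mul_of_nonneg_left ?_ (he j).le
  have h2 : ∀ i, L i j ^ 2 ≤ (if i = j then 1 else 0) + if j < i then (1 / 4 : ℝ) else 0 := by
    intro i
    rcases lt_trichotomy i j with h | rfl | h
    · simp [hL.1 i j h, h.ne, h.not_gt]
    · simp [hL.2]
    · have h3 := sq_le_sq' (abs_le.1 (hred i j h)).1 (abs_le.1 (hred i j h)).2
      simp only [h.ne', h, if_true, if_false]
      linarith
  refine (Finset.sum_le_sum fun i _ => h2 i).trans (le_of_eq ?_)
  rw [Finset.sum_add_distrib, ← Finset.sum_filter (fun i => j < i), Finset.filter_lt_eq_Ioi,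
    Finset.sum_const, Fin.card_Ioi]
  simp
  ring

lemma exists_siegelEquiv_trace_imInv_le (hZ : Z ∈ SiegelUpperHalf g) (hg : 0 < g) {r : ℝ}
    (hr : 4 / 3 < r) :
    ∃ Z', SiegelEquiv Z Z' ∧
      (imInv Z').trace ≤ √r * ∑ m ∈ Finset.range g, r ^ m * (1 + (m : ℝ) / 4) := by
  have hr0 : 0 < r := by linarith
  set ρ := 4 * r / (4 + r) with hρ'
  have hρ : 1 < ρ := by rw [hρ', lt_div_iff₀ (by positivity)]; linarith
  set l : Fin g := ⟨g - 1, by omega⟩ with hl'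
  have hl : l.val + 1 = g := by simp only [hl']; omega
  obtain ⟨Z', L, e, h, hL, he, hW, hred, hre, hmin⟩ := exists_size_reduced_siegelEquiv hZ hρ l
  have hZ' := h.mem hZ
  have hmin' := fun Z'' h'' => hmin Z'' (h.trans hZ h'')
  have hstep : ∀ i i' : Fin g, i'.val = i.val + 1 → e i ≤ r * e i' := by
    intro i i' hi
    have h1 := diag_entry_le_of_minorProduct_le hZ' hL he hW hred hρ hmin' hi
    rw [hρ', div_mul_eq_mul_div, le_div_iff₀ (by positivity)] at h1
    nlinarith
  have hlast : e l ≤ √r := by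
    have h1 := one_le_norm_sq_of_minorProduct_le hZ' hmin' hl
    have h2 := mul_im_last_eq_one hZ' hL hW hl
    rw [← Complex.normSq_eq_norm_sq, Complex.normSq_apply, hρ', div_mul_eq_mul_div,
      le_div_iff₀ (by positivity)] at h1
    have h3 : (Z' l l).re * (Z' l l).re ≤ 1 / 4 := by
      have := sq_le_sq' (abs_le.1 hre).1 (abs_le.1 hre).2
      nlinarith
    have h4 : 1 ≤ r * ((Z' l l).im * (Z' l l).im) := by nlinarith
    refine Real.le_sqrt_of_sq_le ?_
    have h5 : (e l * (Z' l l).im) ^ 2 = 1 := by rw [h2]; norm_num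
    nlinarith [sq_nonneg (e l)]
  have hall : ∀ m : ℕ, ∀ i : Fin g, i.val + 1 + m = g → e i ≤ √r * r ^ m := by
    intro m
    induction m with
    | zero =>
      intro i hi
      have : i = l := Fin.ext (by omega)
      rw [this, pow_zero, mul_one]
      exact hlast
    | succ m ih =>
      intro i hi
      have h1 := ih ⟨i.val + 1, by omega⟩ (by simp only; omega)
      refine (hstep i ⟨i.val + 1, by omega⟩ rfl).trans ?_
      calc r * e ⟨i.val + 1, by omega⟩ ≤ r * (√r * r ^ m) := mul_le_mul_of_nonneg_left h1 hr0.le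
        _ = _ := by ring
  refine ⟨Z', h, ?_⟩
  rw [hW]
  refine (trace_le_of_size_reduced hL he hred).trans ?_
  rw [← Finset.sum_range_reflect, ← Fin.sum_univ_eq_sum_range
    (fun j => r ^ (g - 1 - j) * (1 + ((g - 1 - j : ℕ) : ℝ) / 4)), Finset.mul_sum]
  refine Finset.sum_le_sum fun j _ => ?_
  rw [← mul_assoc]
  exact mul_le_mul_of_nonneg_right (hall _ j (by omega)) (by positivity)

end Reduction

section FourierExpansion

variable {g k : ℕ}

lemma IsPDHalfIntegral.exists_two_smul_eq_map {T : Matrix (Fin g) (Fin g) ℝ}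
    (hT : IsPDHalfIntegral T) :
    ∃ N : Matrix (Fin g) (Fin g) ℤ, (2 : ℝ) • T = N.map (Int.cast : ℤ → ℝ) := by
  have h : ∀ i j, ∃ n : ℤ, 2 * T i j = n := by
    intro i j
    rcases eq_or_ne i j with rfl | hij
    · obtain ⟨n, hn⟩ := hT.2.2.1 i
      exact ⟨2 * n, by rw [hn]; push_cast; ring⟩
    · obtain ⟨n, hn⟩ := hT.2.2.2 i j hij
      exact ⟨n, by rw [hn]; ring⟩
  choose N hN using h
  exact ⟨Matrix.of N, by ext i j; simp [hN]⟩

lemma IsPDHalfIntegral.exists_trace_eq {T : Matrix (Fin g) (Fin g) ℝ}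
    (hT : IsPDHalfIntegral T) : ∃ n : ℤ, T.trace = n := by
  choose n hn using hT.2.2.1
  exact ⟨∑ i, n i, by simp [trace, hn]⟩

lemma IsPDHalfIntegral.det_le_trace_pow {T Y : Matrix (Fin g) (Fin g) ℝ}
    (hT : IsPDHalfIntegral T) (hY : Y.PosDef) : Y.det ≤ (2 * (T * Y).trace) ^ g := by
  obtain ⟨N, hN⟩ := hT.exists_two_smul_eq_map
  have h2 := hT.2.1.smul (zero_lt_two (α := ℝ))
  have h1 := det_mul_det_le_trace_pow h2.posSemidef hY.posSemidef
  have h3 := h2.det_pos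
  have h4 : ((2 : ℝ) • T).det = ((N.det : ℤ) : ℝ) := by
    rw [hN]
    exact (RingHom.map_det (Int.castRingHom ℝ) N).symm
  rw [h4] at h3 h1
  have h5 : (1 : ℝ) ≤ ((N.det : ℤ) : ℝ) := by exact_mod_cast Int.cast_pos.1 h3
  rw [Matrix.smul_mul, trace_smul, smul_eq_mul, Fintype.card_fin] at h1
  exact (le_mul_of_one_le_left hY.det_pos.le h5).trans h1

/-- The absolute value of the `T`-th term of the Fourier expansion at imaginary part `Y`. -/
def SiegelCuspForm.termNorm (F : SiegelCuspForm g k) (Y : Matrix (Fin g) (Fin g) ℝ)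
    (T : {T : Matrix (Fin g) (Fin g) ℝ // IsPDHalfIntegral T}) : ℝ :=
  ‖F.coeff T.1‖ * Real.exp (-(2 * Real.pi * (T.1 * Y).trace))

variable (F : SiegelCuspForm g k)

lemma SiegelCuspForm.termNorm_nonneg (Y : Matrix (Fin g) (Fin g) ℝ)
    (T : {T : Matrix (Fin g) (Fin g) ℝ // IsPDHalfIntegral T}) : 0 ≤ F.termNorm Y T := by
  unfold SiegelCuspForm.termNorm
  positivity

lemma SiegelCuspForm.norm_term (Z : Matrix (Fin g) (Fin g) ℂ)
    (T : {T : Matrix (Fin g) (Fin g) ℝ // IsPDHalfIntegral T}) :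
    ‖F.coeff T.1 * Complex.exp (2 * Real.pi * Complex.I *
      ((T.1.map (Complex.ofReal)) * Z).trace)‖ = F.termNorm (Z.map Complex.im) T := by
  have h : ((T.1.map Complex.ofReal * Z).trace).im = (T.1 * Z.map Complex.im).trace := by
    simp [trace, Matrix.mul_apply]
  rw [norm_mul, Complex.norm_exp, SiegelCuspForm.termNorm, ← h]
  congr 2
  simp [Complex.mul_re, Complex.mul_im]

lemma SiegelCuspForm.norm_le_tsum {Z : Matrix (Fin g) (Fin g) ℂ} (hZ : Z ∈ SiegelUpperHalf g)
    (hs : Summable (F.termNorm (Z.map Complex.im))) :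
    ‖F.toFun Z‖ ≤ ∑' T, F.termNorm (Z.map Complex.im) T := by
  rw [F.fourier Z hZ]
  rw [← funext (F.norm_term Z)] at hs ⊢
  exact norm_tsum_le_tsum_norm hs

lemma SiegelCuspForm.eq_zero_of_not_summable {Z : Matrix (Fin g) (Fin g) ℂ}
    (hZ : Z ∈ SiegelUpperHalf g) (hs : ¬ Summable (F.termNorm (Z.map Complex.im))) :
    F.toFun Z = 0 := by
  rw [F.fourier Z hZ]
  apply tsum_eq_zero_of_not_summable
  intro h
  apply hs
  have := h.norm
  simpa only [F.norm_term Z] using this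

lemma SiegelCuspForm.termNorm_le {Y Y' : Matrix (Fin g) (Fin g) ℝ} (h : (Y - Y').PosSemidef)
    (T : {T : Matrix (Fin g) (Fin g) ℝ // IsPDHalfIntegral T}) :
    F.termNorm Y T ≤ F.termNorm Y' T := by
  have h1 := trace_mul_nonneg T.2.2.1.posSemidef h
  rw [Matrix.mul_sub, trace_sub] at h1
  unfold SiegelCuspForm.termNorm
  have := Real.pi_pos
  gcongr
  linarith

lemma SiegelCuspForm.differentiableOn_line {Z M : Matrix (Fin g) (Fin g) ℂ} {U : Set ℂ}
    (hU : ∀ w ∈ U, Z + w • M ∈ SiegelUpperHalf g) :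
    DifferentiableOn ℂ (fun w : ℂ => F.toFun (Z + w • M)) U := by
  have h : Differentiable ℂ (fun w : ℂ => Z + w • M) :=
    (differentiable_id.smul_const M).const_add Z
  exact F.holo.comp h.differentiableOn hU

lemma SiegelCuspForm.summable_termNorm (hF : ∃ Z ∈ SiegelUpperHalf g, F.toFun Z ≠ 0)
    {Y : Matrix (Fin g) (Fin g) ℝ} (hY : Y.PosDef) : Summable (F.termNorm Y) := by
  by_contra hs
  obtain ⟨Z₀, hZ₀, hne⟩ := hF
  obtain ⟨μ, hμ, -, hYμ⟩ := hY.exists_pos_sub_smul_one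
  set Y₀ := Z₀.map Complex.im with hY₀
  have ht := hZ₀.2.posSemidef.trace_nonneg
  have hline : ∀ w : ℂ, ((Z₀.map Complex.re).map Complex.ofReal +
      w • Y₀.map Complex.ofReal).map Complex.im = w.im • Y₀ := by
    intro w
    ext i j
    simp
  have hU : ∀ w ∈ {w : ℂ | 0 < w.im}, (Z₀.map Complex.re).map Complex.ofReal +
      w • Y₀.map Complex.ofReal ∈ SiegelUpperHalf g := by
    intro w hw
    refine ⟨?_, ?_⟩
    · have h1 := hZ₀.1
      ext i j
      have h2 := h1.apply i j
      simp [hY₀, h2]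
    · rw [hline]
      exact hZ₀.2.smul hw
  have hopen : IsOpen {w : ℂ | 0 < w.im} := isOpen_lt continuous_const Complex.continuous_im
  have hana := (F.differentiableOn_line hU).analyticOnNhd hopen
  set v₀ := μ / (Y₀.trace + 1) with hv₀
  have hv₀pos : 0 < v₀ := by positivity
  have hzero : ∀ w : ℂ, 0 < w.im → w.im < v₀ → F.toFun ((Z₀.map Complex.re).map Complex.ofReal +
      w • Y₀.map Complex.ofReal) = 0 := by
    intro w hw hw'
    refine F.eq_zero_of_not_summable (hU w hw) fun hs' => hs ?_
    rw [hline] at hs'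
    refine Summable.of_nonneg_of_le (F.termNorm_nonneg Y) (fun T => F.termNorm_le ?_ T) hs'
    have h1 : w.im * Y₀.trace ≤ μ := by
      rw [hv₀, lt_div_iff₀ (by positivity)] at hw'
      nlinarith
    have h2 := (hYμ.add (hZ₀.2.posSemidef.trace_smul_one_sub.smul hw.le)).add
      ((PosSemidef.one (n := Fin g) (R := ℝ)).smul (sub_nonneg.2 h1))
    convert h2 using 1
    module
  have hEq := hana.eqOn_zero_of_preconnected_of_eventuallyEq_zero
    (convex_halfSpace_im_gt 0).isPreconnected
    (z₀ := ((v₀ / 2 : ℝ) : ℂ) * Complex.I) (by simp; positivity) (by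
      have hmem : ((v₀ / 2 : ℝ) : ℂ) * Complex.I ∈ {w : ℂ | 0 < w.im} ∩ {w : ℂ | w.im < v₀} := by
        constructor
        · simp; positivity
        · simp; linarith
      filter_upwards [(hopen.inter (isOpen_lt Complex.continuous_im continuous_const)).mem_nhds
        hmem] with w hw
      exact hzero w hw.1 hw.2)
  have h1 := hEq (show Complex.I ∈ {w : ℂ | 0 < w.im} by simp)
  have h2 : (Z₀.map Complex.re).map Complex.ofReal + Complex.I • Y₀.map Complex.ofReal = Z₀ := by
    ext i j
    simp only [hY₀, Matrix.add_apply, map_apply, Matrix.smul_apply, smul_eq_mul]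
    rw [mul_comm]
    exact Complex.re_add_im _
  simp only [h2, Pi.zero_apply] at h1
  exact hne h1

end FourierExpansion

section InvariantNorm

variable {g k : ℕ} (F : SiegelCuspForm g k)

/-- The `Sp_g(ℤ)`-invariant function `|F(Z)|² det(Im Z)^k`. -/
def SiegelCuspForm.invariantNorm (Z : Matrix (Fin g) (Fin g) ℂ) : ℝ :=
  ‖F.toFun Z‖ ^ 2 * (Z.map Complex.im).det ^ k

lemma SiegelCuspForm.invariantNorm_eq {Z Z' : Matrix (Fin g) (Fin g) ℂ}
    (hZ : Z ∈ SiegelUpperHalf g) (h : SiegelEquiv Z Z') :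
    F.invariantNorm Z' = F.invariantNorm Z := by
  obtain ⟨A, B, C, D, h, rfl⟩ := h
  have h1 : F.toFun (siegelAct A B C D Z) = (siegelDenom C D Z).det ^ k * F.toFun Z :=
    F.transform A B C D h Z hZ
  unfold SiegelCuspForm.invariantNorm
  rw [h1, ← norm_sq_det_mul_det_im_siegelAct h hZ, norm_mul, norm_pow]
  ring

lemma SiegelCuspForm.invariantNorm_le_of_trace_le (hg : 0 < g)
    (hF : ∃ Z ∈ SiegelUpperHalf g, F.toFun Z ≠ 0) {b : ℝ} (hb : 0 < b) :
    ∃ K : ℝ, ∀ Z ∈ SiegelUpperHalf g, (imInv Z).trace ≤ b → F.invariantNorm Z ≤ K := by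
  have hpi := Real.pi_pos
  set S := ∑' T, F.termNorm ((2 * b)⁻¹ • (1 : Matrix (Fin g) (Fin g) ℝ)) T with hS
  have hsum : Summable (F.termNorm ((2 * b)⁻¹ • (1 : Matrix (Fin g) (Fin g) ℝ))) :=
    F.summable_termNorm hF (PosDef.one.smul (by positivity))
  have hS0 : 0 ≤ S := tsum_nonneg (F.termNorm_nonneg _)
  refine ⟨S ^ 2 * (g * k).factorial, fun Z hZ htr => ?_⟩
  set Y := Z.map Complex.im with hY
  set x := Y.det ^ ((g : ℝ)⁻¹) with hx
  have hdet := hZ.2.det_pos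
  have hx0 : 0 ≤ x := Real.rpow_nonneg hdet.le _
  have hxg : x ^ g = Y.det := Real.rpow_inv_natCast_pow hdet.le hg.ne'
  have hYb : (Y - b⁻¹ • (1 : Matrix (Fin g) (Fin g) ℝ)).PosSemidef := by
    have := (imInv_posDef hZ).inv_sub_inv_trace hb htr
    rwa [imInv, nonsing_inv_nonsing_inv _ (isUnit_iff_ne_zero.2 hdet.ne')] at this
  have hterm : ∀ T, F.termNorm Y T ≤
      Real.exp (-(Real.pi * (x / 2))) * F.termNorm ((2 * b)⁻¹ • 1) T := by
    intro T
    have h1 := trace_mul_nonneg T.2.2.1.posSemidef hYb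
    have hTY := trace_mul_nonneg T.2.2.1.posSemidef hZ.2.posSemidef
    rw [Matrix.mul_sub, trace_sub, Matrix.mul_smul, trace_smul, Matrix.mul_one, smul_eq_mul] at h1
    have h2 : x ≤ 2 * (T.1 * Y).trace := by
      refine le_of_pow_le_pow_left₀ hg.ne' (by positivity) ?_
      rw [hxg]
      exact T.2.det_le_trace_pow hZ.2
    unfold SiegelCuspForm.termNorm
    rw [mul_left_comm, ← Real.exp_add, Matrix.mul_smul, trace_smul, Matrix.mul_one, smul_eq_mul,
      mul_inv]
    gcongr
    have h3 : Real.pi * (x / 2) ≤ Real.pi * (T.1 * Y).trace := by gcongr; linarith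
    have h4 : Real.pi * (b⁻¹ * T.1.trace) ≤ Real.pi * (T.1 * Y).trace := by gcongr; linarith
    linarith
  have hYs : Summable (F.termNorm Y) := F.summable_termNorm hF hZ.2
  have hnorm : ‖F.toFun Z‖ ≤ Real.exp (-(Real.pi * (x / 2))) * S := by
    refine (F.norm_le_tsum hZ hYs).trans ?_
    rw [hS, ← tsum_mul_left]
    exact hYs.tsum_le_tsum hterm (hsum.mul_left _)
  have hpow : x ^ (g * k) ≤ (g * k).factorial * Real.exp (Real.pi * x) := by
    have h1 := Real.pow_div_factorial_le_exp x hx0 (g * k)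
    rw [div_le_iff₀ (by positivity), mul_comm (Real.exp x)] at h1
    refine h1.trans ?_
    gcongr
    nlinarith [Real.pi_gt_three]
  unfold SiegelCuspForm.invariantNorm
  rw [← hxg, ← pow_mul]
  calc ‖F.toFun Z‖ ^ 2 * x ^ (g * k)
      ≤ (Real.exp (-(Real.pi * (x / 2))) * S) ^ 2 *
        ((g * k).factorial * Real.exp (Real.pi * x)) := by gcongr
    _ = S ^ 2 * (g * k).factorial *
        (Real.exp (-(Real.pi * (x / 2))) ^ 2 * Real.exp (Real.pi * x)) := by ring
    _ = S ^ 2 * (g * k).factorial := by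
        rw [← Real.exp_nat_mul, ← Real.exp_add]
        have : ((2 : ℕ) : ℝ) * -(Real.pi * (x / 2)) + Real.pi * x = 0 := by push_cast; ring
        rw [this, Real.exp_zero, mul_one]

lemma SiegelCuspForm.bddAbove_invariantNorm (hg : 0 < g)
    (hF : ∃ Z ∈ SiegelUpperHalf g, F.toFun Z ≠ 0) :
    BddAbove (F.invariantNorm '' SiegelUpperHalf g) := by
  obtain ⟨K, hK⟩ := F.invariantNorm_le_of_trace_le hg hF
    (b := √2 * ∑ m ∈ Finset.range g, 2 ^ m * (1 + (m : ℝ) / 4))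
    (mul_pos (by positivity) (Finset.sum_pos (fun m _ => by positivity)
      (Finset.nonempty_range_iff.2 hg.ne')))
  refine ⟨K, ?_⟩
  rintro _ ⟨Z, hZ, rfl⟩
  obtain ⟨Z', h, htr⟩ := exists_siegelEquiv_trace_imInv_le hZ hg (r := 2) (by norm_num)
  rw [← F.invariantNorm_eq hZ h]
  exact hK Z' (h.mem hZ) htr

lemma posDef_add_smul_one {Y : Matrix (Fin g) (Fin g) ℝ} {β s : ℝ}
    (hY : (Y - β • (1 : Matrix (Fin g) (Fin g) ℝ)).PosSemidef) (hs : 0 < β + s) :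
    (Y + s • (1 : Matrix (Fin g) (Fin g) ℝ)).PosDef := by
  have := PosDef.posSemidef_add hY ((PosDef.one (n := Fin g) (R := ℝ)).smul hs)
  convert this using 1
  module

lemma SiegelCuspForm.norm_mul_exp_le (hF : ∃ Z ∈ SiegelUpperHalf g, F.toFun Z ≠ 0)
    {K : ℝ} (hK : ∀ Z ∈ SiegelUpperHalf g, F.invariantNorm Z ≤ K)
    {c : ℝ} (hc : ∀ T, IsPDHalfIntegral T → F.coeff T ≠ 0 → c ≤ T.trace)
    {Z : Matrix (Fin g) (Fin g) ℂ} (hZ : Z ∈ SiegelUpperHalf g) {β ε : ℝ}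
    (hβ : (Z.map Complex.im - β • (1 : Matrix (Fin g) (Fin g) ℝ)).PosSemidef)
    (hε : 0 ≤ ε) (hεβ : ε < β) :
    ‖F.toFun Z‖ ^ 2 * Real.exp (4 * Real.pi * c * ε) *
      (Z.map Complex.im - ε • (1 : Matrix (Fin g) (Fin g) ℝ)).det ^ k ≤ K := by
  have hpi := Real.pi_pos
  set Y := Z.map Complex.im with hY
  have hYε : (Y - ε • (1 : Matrix (Fin g) (Fin g) ℝ)).PosDef := by
    have := posDef_add_smul_one hβ (s := -ε) (by linarith)
    rwa [neg_smul, ← sub_eq_add_neg] at this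
  set d := (Y - ε • (1 : Matrix (Fin g) (Fin g) ℝ)).det with hd
  have hd0 : 0 < d := hYε.det_pos
  set P : ℂ → Matrix (Fin g) (Fin g) ℂ := fun s =>
    (Z - (ε * Complex.I) • (1 : Matrix (Fin g) (Fin g) ℂ)) +
      s • (Complex.I • (1 : Matrix (Fin g) (Fin g) ℂ)) with hP
  have hPim : ∀ s, (P s).map Complex.im = Y + (s.re - ε) • (1 : Matrix (Fin g) (Fin g) ℝ) := by
    intro s
    ext i j
    rcases eq_or_ne i j with rfl | hij
    · simp [hP, hY]; ring
    · simp [hP, hY, hij]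
  have hPmem : ∀ s ∈ {s : ℂ | -(β - ε) < s.re}, P s ∈ SiegelUpperHalf g := by
    intro s hs
    refine ⟨?_, ?_⟩
    · exact (hZ.1.sub (isSymm_one.smul _)).add ((isSymm_one.smul _).smul _)
    · rw [hPim]
      refine posDef_add_smul_one hβ ?_
      have : -(β - ε) < s.re := hs
      linarith
  set f : ℂ → ℂ := fun s => F.toFun (P s) * Complex.exp (2 * Real.pi * c * s) with hf
  have hfd : DifferentiableOn ℂ f {s : ℂ | -(β - ε) < s.re} :=
    (F.differentiableOn_line hPmem).mul (by fun_prop)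
  have hcl : closure {s : ℂ | 0 < s.re} ⊆ {s : ℂ | -(β - ε) < s.re} := by
    rw [Complex.closure_setOfPred_lt_re]
    intro s hs
    have : 0 ≤ s.re := hs
    show -(β - ε) < s.re
    linarith
  have hexp : ∀ s : ℂ, ‖Complex.exp (2 * Real.pi * c * s)‖ =
      Real.exp (2 * Real.pi * c * s.re) := by
    intro s
    rw [Complex.norm_exp]
    congr 1
    simp
  have hsum := F.summable_termNorm hF hYε
  set S := ∑' T, F.termNorm (Y - ε • (1 : Matrix (Fin g) (Fin g) ℝ)) T with hS
  have hbound : ∀ s : ℂ, 0 ≤ s.re → ‖f s‖ ≤ S := by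
    intro s hs
    have hmem : P s ∈ SiegelUpperHalf g := hPmem s (show -(β - ε) < s.re by linarith)
    have hsum' := F.summable_termNorm hF hmem.2
    have h1 : ∀ T, F.termNorm ((P s).map Complex.im) T ≤
        F.termNorm (Y - ε • (1 : Matrix (Fin g) (Fin g) ℝ)) T *
          Real.exp (-(2 * Real.pi * c * s.re)) := by
      intro T
      rcases eq_or_ne (F.coeff T.1) 0 with h0 | h0
      · simp [SiegelCuspForm.termNorm, h0]
      · have h2 : c * s.re ≤ T.1.trace * s.re :=
          mul_le_mul_of_nonneg_right (hc T.1 T.2 h0) hs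
        rw [hPim]
        unfold SiegelCuspForm.termNorm
        rw [mul_assoc ‖F.coeff T.1‖, ← Real.exp_add]
        gcongr
        simp only [Matrix.mul_add, Matrix.mul_sub, Matrix.mul_smul, Matrix.mul_one, trace_add,
          trace_sub, trace_smul, smul_eq_mul]
        nlinarith
    have h2 : ‖F.toFun (P s)‖ ≤ S * Real.exp (-(2 * Real.pi * c * s.re)) := by
      refine (F.norm_le_tsum hmem hsum').trans ?_
      rw [hS, ← tsum_mul_right]
      exact hsum'.tsum_le_tsum h1 (hsum.mul_right _)
    calc ‖f s‖ = ‖F.toFun (P s)‖ * Real.exp (2 * Real.pi * c * s.re) := by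
          rw [hf, norm_mul, hexp]
      _ ≤ S * Real.exp (-(2 * Real.pi * c * s.re)) * Real.exp (2 * Real.pi * c * s.re) := by
          gcongr
      _ = S := by
          rw [mul_assoc, ← Real.exp_add, neg_add_cancel, Real.exp_zero, mul_one]
  have him : ∀ y : ℝ, ‖f (y * Complex.I)‖ ≤ √(K / d ^ k) := by
    intro y
    have hmem : P (y * Complex.I) ∈ SiegelUpperHalf g := hPmem _ (by simp; linarith)
    have h1 := hK _ hmem
    rw [SiegelCuspForm.invariantNorm, hPim] at h1
    have h2 : Y + (((y : ℂ) * Complex.I).re - ε) • (1 : Matrix (Fin g) (Fin g) ℝ) =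
        Y - ε • (1 : Matrix (Fin g) (Fin g) ℝ) := by
      simp [sub_eq_add_neg]
    rw [h2, ← hd] at h1
    refine Real.le_sqrt_of_sq_le ?_
    rw [le_div_iff₀ (by positivity)]
    have h3 : ‖f (y * Complex.I)‖ = ‖F.toFun (P (y * Complex.I))‖ := by
      simp only [hf]
      rw [norm_mul, hexp]
      simp
    rw [h3]
    exact h1
  have hPL : ‖f (ε : ℂ)‖ ≤ √(K / d ^ k) := by
    refine PhragmenLindelof.right_half_plane_of_bounded_on_real
      ⟨hfd.mono (subset_closure.trans hcl), hfd.continuousOn.mono hcl⟩ ⟨0, by norm_num, 0, ?_⟩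
      ⟨S, ?_⟩ him (by simpa using hε)
    · refine Asymptotics.IsBigO.of_bound S ?_
      refine Filter.eventually_inf_principal.2 (Filter.Eventually.of_forall fun s hs => ?_)
      simpa using hbound s (le_of_lt hs)
    · rw [Filter.eventually_map]
      filter_upwards [Filter.eventually_ge_atTop 0] with x hx
      exact hbound x (by simpa using hx)
  have hfε : ‖f (ε : ℂ)‖ = ‖F.toFun Z‖ * Real.exp (2 * Real.pi * c * ε) := by
    have h1 : P (ε : ℂ) = Z := by
      simp only [hP]
      rw [smul_smul, sub_add_cancel]
    rw [hf, norm_mul, hexp, h1, Complex.ofReal_re]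
  have hK0 : 0 ≤ K / d ^ k := div_nonneg
    ((mul_nonneg (by positivity) (pow_nonneg hZ.2.det_pos.le _)).trans (hK Z hZ)) (by positivity)
  rw [hfε] at hPL
  have h1 := pow_le_pow_left₀ (by positivity) hPL 2
  rw [Real.sq_sqrt hK0, mul_pow, ← Real.exp_nat_mul, le_div_iff₀ (by positivity)] at h1
  have h2 : ((2 : ℕ) : ℝ) * (2 * Real.pi * c * ε) = 4 * Real.pi * c * ε := by push_cast; ring
  rwa [h2] at h1

end InvariantNorm

section TraceBound

variable {g k : ℕ} (F : SiegelCuspForm g k)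

lemma SiegelCuspForm.invariantNorm_mul_le (hF : ∃ Z ∈ SiegelUpperHalf g, F.toFun Z ≠ 0)
    {K : ℝ} (hK : ∀ Z ∈ SiegelUpperHalf g, F.invariantNorm Z ≤ K)
    {c : ℝ} (hc : ∀ T, IsPDHalfIntegral T → F.coeff T ≠ 0 → c ≤ T.trace)
    {Z : Matrix (Fin g) (Fin g) ℂ} (hZ : Z ∈ SiegelUpperHalf g) {b ε : ℝ} (hb : 0 < b)
    (hZb : (imInv Z).trace ≤ b) (hε : 0 ≤ ε) (hεb : ε * b < 1) :
    F.invariantNorm Z * (Real.exp (4 * Real.pi * c * ε) * (1 - ε * b) ^ k) ≤ K := by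
  have hdet := hZ.2.det_pos
  have hu : IsUnit (Z.map Complex.im).det := isUnit_iff_ne_zero.2 hdet.ne'
  have hβ := (imInv_posDef hZ).inv_sub_inv_trace hb hZb
  rw [imInv, nonsing_inv_nonsing_inv _ hu] at hβ
  have hle := F.norm_mul_exp_le hF hK hc hZ hβ hε (by rwa [← one_div, lt_div_iff₀ hb])
  have htr : ε * (imInv Z).trace ≤ ε * b := mul_le_mul_of_nonneg_left hZb hε
  have h1 := one_sub_mul_trace_le_det (imInv_posDef hZ).posSemidef hε (by linarith)
  have h2 : Z.map Complex.im - ε • (1 : Matrix (Fin g) (Fin g) ℝ) =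
      Z.map Complex.im * (1 - ε • imInv Z) := by
    rw [Matrix.mul_sub, Matrix.mul_one, Matrix.mul_smul, imInv, mul_nonsing_inv _ hu]
  rw [h2, det_mul, mul_pow] at hle
  refine le_trans ?_ hle
  unfold SiegelCuspForm.invariantNorm
  have h3 : (1 - ε * b) ^ k ≤ (1 - ε • imInv Z).det ^ k :=
    pow_le_pow_left₀ (by linarith) (by linarith) k
  calc _ = ‖F.toFun Z‖ ^ 2 * Real.exp (4 * Real.pi * c * ε) *
        ((Z.map Complex.im).det ^ k * (1 - ε * b) ^ k) := by ring
    _ ≤ _ := by gcongr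

lemma SiegelCuspForm.exp_mul_pow_le_one (hF : ∃ Z ∈ SiegelUpperHalf g, F.toFun Z ≠ 0)
    (hg : 0 < g) {c : ℝ} (hc : ∀ T, IsPDHalfIntegral T → F.coeff T ≠ 0 → c ≤ T.trace)
    {b ε : ℝ} (hb : 0 < b)
    (hred : ∀ Z ∈ SiegelUpperHalf g, ∃ Z', SiegelEquiv Z Z' ∧ (imInv Z').trace ≤ b)
    (hε : 0 ≤ ε) (hεb : ε * b < 1) :
    Real.exp (4 * Real.pi * c * ε) * (1 - ε * b) ^ k ≤ 1 := by
  set M := sSup (F.invariantNorm '' SiegelUpperHalf g) with hM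
  have hbdd := F.bddAbove_invariantNorm hg hF
  have hle : ∀ Z ∈ SiegelUpperHalf g, F.invariantNorm Z ≤ M := fun Z hZ =>
    le_csSup hbdd ⟨Z, hZ, rfl⟩
  obtain ⟨Z₀, hZ₀, hne⟩ := hF
  have hpos : 0 < M := lt_of_lt_of_le
    (mul_pos (pow_pos (norm_pos_iff.2 hne) 2) (pow_pos hZ₀.2.det_pos k)) (hle Z₀ hZ₀)
  set q := Real.exp (4 * Real.pi * c * ε) * (1 - ε * b) ^ k with hq
  have hq0 : 0 < q := mul_pos (Real.exp_pos _) (pow_pos (by linarith) k)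
  have h1 : M ≤ M / q := by
    refine csSup_le ⟨_, Z₀, hZ₀, rfl⟩ ?_
    rintro _ ⟨Z, hZ, rfl⟩
    obtain ⟨Z', h, htr⟩ := hred Z hZ
    rw [le_div_iff₀ hq0, ← F.invariantNorm_eq hZ h]
    exact F.invariantNorm_mul_le ⟨Z₀, hZ₀, hne⟩ hle hc (h.mem hZ) hb htr hε hεb
  rw [le_div_iff₀ hq0] at h1
  exact le_of_mul_le_mul_left (by rwa [mul_one]) hpos

lemma le_of_forall_exp_mul_pow_le_one {a b : ℝ} (ha : 0 ≤ a) (k : ℕ)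
    (h : ∀ ε : ℝ, 0 ≤ ε → ε * b < 1 → Real.exp (a * ε) * (1 - ε * b) ^ k ≤ 1) : a ≤ k * b := by
  have hlim : Filter.Tendsto (fun ε : ℝ => a - k * b - a * (k * b) * ε)
      (nhdsWithin 0 (Set.Ioi 0)) (nhds (a - k * b)) := by
    have : Continuous fun ε : ℝ => a - k * b - a * (k * b) * ε := by fun_prop
    have h1 := this.tendsto 0
    simp only [mul_zero, sub_zero] at h1
    exact h1.mono_left nhdsWithin_le_nhds
  have hev : ∀ᶠ ε : ℝ in nhdsWithin 0 (Set.Ioi 0), a - k * b - a * (k * b) * ε ≤ 0 := by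
    have h1 : ∀ᶠ ε : ℝ in nhds 0, ε * b < 1 := by
      refine (continuous_mul_const b).continuousAt.eventually_lt continuousAt_const ?_
      simp
    filter_upwards [self_mem_nhdsWithin, nhdsWithin_le_nhds h1] with ε hε hεb
    have hε0 : 0 < ε := hε
    have h2 := h ε hε0.le hεb
    have h3 := one_add_mul_le_pow (a := -(ε * b)) (by linarith) k
    have h4 := Real.add_one_le_exp (a * ε)
    rw [← sub_eq_add_neg] at h3
    have h5 : (a * ε + 1) * (1 - k * (ε * b)) ≤ 1 := by
      calc (a * ε + 1) * (1 - k * (ε * b)) ≤ (a * ε + 1) * (1 - ε * b) ^ k := by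
            gcongr
            linarith
        _ ≤ Real.exp (a * ε) * (1 - ε * b) ^ k := by
            gcongr
        _ ≤ 1 := h2
    have h6 : ε * (a - k * b - a * (k * b) * ε) ≤ 0 := by nlinarith
    exact nonpos_of_mul_nonpos_right h6 hε0
  have := le_of_tendsto hlim hev
  linarith

lemma sum_four_thirds_pow (n : ℕ) :
    ∑ m ∈ Finset.range (n + 1), (4 / 3 : ℝ) ^ m * (1 + (m : ℝ) / 4) =
      ((n + 1 : ℕ) : ℝ) * (4 / 3) ^ n := by
  induction n with
  | zero => simp
  | succ n ih =>
    rw [Finset.sum_range_succ, ih]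
    push_cast
    ring

lemma SiegelCuspForm.le_of_forall_coeff_ne_zero (hF : ∃ Z ∈ SiegelUpperHalf g, F.toFun Z ≠ 0)
    (hg : 0 < g) {c : ℝ} (hc0 : 0 ≤ c)
    (hc : ∀ T, IsPDHalfIntegral T → F.coeff T ≠ 0 → c ≤ T.trace) :
    4 * Real.pi * c ≤ k * (√(4 / 3) * (g * (4 / 3) ^ (g - 1))) := by
  have hpi := Real.pi_pos
  have hr : ∀ r : ℝ, 4 / 3 < r → 4 * Real.pi * c ≤
      k * (√r * ∑ m ∈ Finset.range g, r ^ m * (1 + (m : ℝ) / 4)) := by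
    intro r hr
    have hr0 : 0 < r := by linarith
    have hb : 0 < √r * ∑ m ∈ Finset.range g, r ^ m * (1 + (m : ℝ) / 4) :=
      mul_pos (by positivity) (Finset.sum_pos (fun m _ => by positivity)
        (Finset.nonempty_range_iff.2 hg.ne'))
    exact le_of_forall_exp_mul_pow_le_one (by positivity) k fun ε hε hεb =>
      F.exp_mul_pow_le_one hF hg hc hb
        (fun Z hZ => exists_siegelEquiv_trace_imInv_le hZ hg hr) hε hεb
  have hcont : Continuous fun r : ℝ =>
      k * (√r * ∑ m ∈ Finset.range g, r ^ m * (1 + (m : ℝ) / 4)) := by fun_prop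
  have hlim := (hcont.tendsto (4 / 3)).mono_left
    (nhdsWithin_le_nhds (s := Set.Ioi (4 / 3 : ℝ)))
  have h1 := ge_of_tendsto hlim (by filter_upwards [self_mem_nhdsWithin] with r h using hr r h)
  obtain ⟨n, rfl⟩ : ∃ n, g = n + 1 := ⟨g - 1, by omega⟩
  rwa [sum_four_thirds_pow] at h1

end TraceBound

/-- A non-zero Siegel cusp form of weight `k` on `Sp_g(ℤ)` has a non-vanishing Fourier
coefficient `a(T₀)` with `tr T₀ ≤ (k/(4π))·(2/√3)·g·(4/3)^(g(g-1)/2)`. -/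
theorem siegel_small_nonzero_coeff (g k : ℕ) (hg : 2 ≤ g) (F : SiegelCuspForm g k)
    (hF : ∃ Z ∈ SiegelUpperHalf g, F.toFun Z ≠ 0) :
    ∃ T₀ : Matrix (Fin g) (Fin g) ℝ, IsPDHalfIntegral T₀ ∧ F.coeff T₀ ≠ 0 ∧
      T₀.trace ≤ ((k : ℝ) / (4 * Real.pi)) * (2 / Real.sqrt 3) * g *
        (4 / 3 : ℝ) ^ (g * (g - 1) / 2) := by
  have hpi := Real.pi_pos
  set R := ((k : ℝ) / (4 * Real.pi)) * (2 / Real.sqrt 3) * g *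
    (4 / 3 : ℝ) ^ (g * (g - 1) / 2) with hR
  by_contra! hcon
  have hR0 : 0 ≤ R := by positivity
  have hfloor : ∀ T, IsPDHalfIntegral T → F.coeff T ≠ 0 → ((⌊R⌋ + 1 : ℤ) : ℝ) ≤ T.trace := by
    intro T hT h0
    have h1 := hcon T hT h0
    obtain ⟨n, hn⟩ := hT.exists_trace_eq
    rw [hn] at h1 ⊢
    exact_mod_cast Int.add_one_le_iff.2 (Int.floor_lt.2 h1)
  have hlt : R < ((⌊R⌋ + 1 : ℤ) : ℝ) := by
    push_cast
    exact Int.lt_floor_add_one R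
  have h1 := F.le_of_forall_coeff_ne_zero hF (by omega) (hR0.trans hlt.le) hfloor
  have h2 : (4 / 3 : ℝ) ^ (g - 1) ≤ (4 / 3 : ℝ) ^ (g * (g - 1) / 2) := by
    refine pow_le_pow_right₀ (by norm_num) ?_
    rw [Nat.le_div_iff_mul_le two_pos, mul_comm]
    exact Nat.mul_le_mul_right _ hg
  have h3 : √(4 / 3 : ℝ) = 2 / √3 := by
    rw [Real.sqrt_div (by norm_num), show (4 : ℝ) = 2 ^ 2 by norm_num,
      Real.sqrt_sq (by norm_num)]
  have h4 : (k : ℝ) * (√(4 / 3) * (g * (4 / 3) ^ (g - 1))) ≤ 4 * Real.pi * R := by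
    rw [h3, hR]
    calc (k : ℝ) * (2 / √3 * (g * (4 / 3) ^ (g - 1)))
        ≤ k * (2 / √3 * (g * (4 / 3) ^ (g * (g - 1) / 2))) := by gcongr
      _ = _ := by field_simp
  have h5 : 4 * Real.pi * R < 4 * Real.pi * ((⌊R⌋ + 1 : ℤ) : ℝ) := by gcongr
  linarith
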